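/- arXiv:0810.0427 — 2 statements merged into one kernel-verified Lean document; each statement's English description precedes it below -/
import Mathlib

section
/- For every natural number n ≥ 1 and every element u of a commutative ring (e.g., every real number u), Σ_{F ∈ F_n} u^{lead(F)} = Σ_{P ∈ PF_n} u^{lucky(P)}. -/
/-!  Parking functions and the parking algorithm. -/

/-- Parking algorithm: cars `0, 1, ..., n-1` (in Lean's 0-based indexing of `Fin n`,
representing cars `1, ..., n`) arrive in order; car `i` drives to its favorite
(1-indexed) space `p i` and parks in the first space `s ≥ p i` not occupied by an
earlier car.  `PA p i` is the space where car `i` actually parks. -/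
noncomputable def PA {n : ℕ} (p : Fin n → ℕ) (i : Fin n) : ℕ :=
  sInf {s : ℕ | p i ≤ s ∧ ∀ j : Fin n, j < i → PA p j ≠ s}
termination_by i.val
decreasing_by exact ‹_ < _›

/-- `p` is a parking function of length `n`: every favorite space is in `{1, ..., n}`
and every car ends up parked in a space `≤ n`. -/
def IsParkingFunction {n : ℕ} (p : Fin n → ℕ) : Prop :=
  (∀ i, 1 ≤ p i ∧ p i ≤ n) ∧ ∀ i, PA p i ≤ n

/-- The set (type) `PF_n` of parking functions of length `n`. -/
def ParkingFunction (n : ℕ) : Type :=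
  {p : Fin n → ℕ // IsParkingFunction p}

instance {n : ℕ} : Finite (ParkingFunction n) := by
  apply Finite.of_injective
    (fun P : ParkingFunction n => fun i => (⟨P.1 i, Nat.lt_succ_of_le (P.2.1 i).2⟩ : Fin (n+1)))
  intro P Q h
  apply Subtype.ext; funext i
  simpa [Fin.mk.injEq] using congrFun h i

noncomputable instance {n : ℕ} : Fintype (ParkingFunction n) := Fintype.ofFinite _

/-- `jumpAt p c` is the number of jumps of car `c`, i.e. `q_c - p_c`. -/
noncomputable def jumpAt {n : ℕ} (p : Fin n → ℕ) (c : Fin n) : ℕ := PA p c - p c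

/-- `jump p` is the total number of jumps. -/
noncomputable def jump {n : ℕ} (p : Fin n → ℕ) : ℕ := ∑ c, jumpAt p c

/-- `luckyCount p k` is the number of cars `c` with `jump(p : c) = k`. -/
noncomputable def luckyCount {n : ℕ} (p : Fin n → ℕ) (k : ℕ) : ℕ :=
  Set.ncard {c : Fin n | jumpAt p c = k}

/-- `lucky p` is the number of lucky cars, i.e. cars with no jumps. -/
noncomputable def lucky {n : ℕ} (p : Fin n → ℕ) : ℕ :=
  Set.ncard {c : Fin n | jumpAt p c = 0}

/-- Car `c` is critical: immediately after car `c` is parked, there is no empty space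
among the spaces strictly to the right of its space `q_c` within `{1, ..., n}`. -/
def IsCritical {n : ℕ} (p : Fin n → ℕ) (c : Fin n) : Prop :=
  ∀ s : ℕ, PA p c < s → s ≤ n → ∃ j : Fin n, j ≤ c ∧ PA p j = s

/-- `critic p` is the number of critical cars. -/
noncomputable def critic {n : ℕ} (p : Fin n → ℕ) : ℕ :=
  Set.ncard {c : Fin n | IsCritical p c}

/-!  Rooted labeled forests, encoded by their parent function. -/

/-- A parent function `par : Fin n → Option (Fin n)` (where `par v = none` means that
`v` is a root) encodes a rooted labeled forest on `n` vertices iff it has no cycles. -/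
def IsForest {n : ℕ} (par : Fin n → Option (Fin n)) : Prop :=
  ∀ v : Fin n, ¬ Relation.TransGen (fun a b => par a = some b) v v

/-- The set (type) `F_n` of rooted labeled forests on `n` vertices. -/
def Forest (n : ℕ) : Type := {par : Fin n → Option (Fin n) // IsForest par}

instance {n : ℕ} : Finite (Forest n) := Subtype.finite
noncomputable instance {n : ℕ} : Fintype (Forest n) := Fintype.ofFinite _

/-- `x` is a descendant of `v`: `v` lies on the (unique) path from the root of `x`'s
component to `x`, i.e. the ancestor chain of `x` reaches `v`. -/
def Descendant {n : ℕ} (par : Fin n → Option (Fin n)) (v x : Fin n) : Prop :=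
  Relation.ReflTransGen (fun a b => par a = some b) x v

/-- `forestInvAt F v = inv(F : v)`, the number of pairs `(v, x)` with `v > x` and
`x` a descendant of `v`. -/
noncomputable def forestInvAt {n : ℕ} (F : Forest n) (v : Fin n) : ℕ :=
  Set.ncard {x : Fin n | x < v ∧ Descendant F.1 v x}

/-- `forestInv F = inv(F)`, the total number of inversions of `F`. -/
noncomputable def forestInv {n : ℕ} (F : Forest n) : ℕ := ∑ v, forestInvAt F v

/-- `forestLeadCount F k` is the number of vertices `v` with `inv(F : v) = k`. -/
noncomputable def forestLeadCount {n : ℕ} (F : Forest n) (k : ℕ) : ℕ :=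
  Set.ncard {v : Fin n | forestInvAt F v = k}

/-- `forestLead F = lead(F)`, the number of leaders of `F`. -/
noncomputable def forestLead {n : ℕ} (F : Forest n) : ℕ :=
  Set.ncard {v : Fin n | forestInvAt F v = 0}

/-- `forestTree F = tree(F)`, the number of trees (connected components) of `F`,
i.e. the number of roots. -/
noncomputable def forestTree {n : ℕ} (F : Forest n) : ℕ :=
  Set.ncard {v : Fin n | F.1 v = none}


section Occupancy

open Finset

/-- The number of positive spaces `p < h` such that a car preferring `p` rolls to `h`
when exactly the spaces in `T` are occupied. -/
def runLength (T : Finset ℕ) (h : ℕ) : ℕ := #{p ∈ Ico 1 h | Ico p h ⊆ T}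

/-- The sum of `u ^ lucky` over all preference lists of `k` cars that end up occupying
exactly the set of spaces `T`, computed by removing the last car. -/
def occupancySum {R : Type*} [CommRing R] (u : R) : ℕ → Finset ℕ → R
  | 0, T => if T = ∅ then 1 else 0
  | k + 1, T => ∑ h ∈ T, (u + runLength (T.erase h) h) * occupancySum u k (T.erase h)

lemma runLength_filter_lt {T : Finset ℕ} {s h : ℕ} (hh : h < s) :
    runLength {x ∈ T | x < s} h = runLength T h := by
  unfold runLength
  congr 1
  refine filter_congr fun p _ => ?_
  simp only [subset_iff, mem_Ico, mem_filter]
  exact ⟨fun H x hx => (H hx).1, fun H x hx => ⟨H hx, by omega⟩⟩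

lemma runLength_filter_gt {T : Finset ℕ} {s h : ℕ} (hs : s ∉ T) (hh : s < h) :
    runLength {x ∈ T | s < x} h = runLength T h := by
  unfold runLength
  congr 1
  refine filter_congr fun p _ => ?_
  simp only [subset_iff, mem_Ico, mem_filter]
  refine ⟨fun H x hx => (H hx).1, fun H x hx => ⟨H hx, ?_⟩⟩
  by_contra hc
  exact hs (H ⟨by omega, hh⟩)

/-- Parking on both sides of a space that stays empty happens independently. -/
lemma occupancySum_split {R : Type*} [CommRing R] (u : R) (k : ℕ) (T : Finset ℕ) (s : ℕ)
    (hs : s ∉ T) (hT : #T = k) :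
    occupancySum u k T = (k.choose #{x ∈ T | x < s} : R) *
      (occupancySum u #{x ∈ T | x < s} {x ∈ T | x < s} *
        occupancySum u #{x ∈ T | s < x} {x ∈ T | s < x}) := by
  induction k generalizing T with
  | zero =>
    rw [card_eq_zero] at hT
    simp [hT, occupancySum]
  | succ k ih =>
    have hcard : #{x ∈ T | x < s} + #{x ∈ T | s < x} = k + 1 := by
      rw [← hT, ← card_union_of_disjoint]
      · congr 1
        ext x
        simp only [mem_union, mem_filter]
        have : x ∈ T → x ≠ s := fun h e => hs (e ▸ h)
        grind
      · rw [disjoint_left]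
        intro x
        simp only [mem_filter]
        omega
    have hsplit : ∀ f : ℕ → R, ∑ h ∈ T, f h =
        ∑ h ∈ T with h < s, f h + ∑ h ∈ T with s < h, f h := by
      intro f
      rw [← sum_filter_add_sum_filter_not T (· < s)]
      congr 2
      refine filter_congr fun x hx => ?_
      have : x ≠ s := fun e => hs (e ▸ hx)
      omega
    have hl : ∑ h ∈ T with h < s, (u + runLength (T.erase h) h) * occupancySum u k (T.erase h)
        = ((k + 1).choose #{x ∈ T | x < s} - k.choose #{x ∈ T | x < s} : R) *
          (occupancySum u #{x ∈ T | x < s} {x ∈ T | x < s} *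
            occupancySum u #{x ∈ T | s < x} {x ∈ T | s < x}) := by
      rcases ha : #{x ∈ T | x < s} with _ | a
      · rw [card_eq_zero] at ha
        simp [ha]
      · rw [Nat.choose_succ_succ, Nat.cast_add, add_sub_cancel_right, occupancySum, sum_mul, mul_sum]
        refine sum_congr rfl fun h hh => ?_
        have hh' := mem_filter.1 hh
        have e1 : {x ∈ T.erase h | x < s} = {x ∈ T | x < s}.erase h := by
          ext; simp only [mem_filter, mem_erase]; tauto
        have e2 : {x ∈ T.erase h | s < x} = {x ∈ T | s < x} := by
          ext; simp only [mem_filter, mem_erase]; grind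
        rw [ih (T.erase h) (by simp [hs]) (by rw [card_erase_of_mem hh'.1, hT]; rfl), e1, e2,
          card_erase_of_mem hh, ha, ← e1, runLength_filter_lt hh'.2, Nat.add_sub_cancel]
        ring
    have hr : ∑ h ∈ T with s < h, (u + runLength (T.erase h) h) * occupancySum u k (T.erase h)
        = (k.choose #{x ∈ T | x < s} : R) *
          (occupancySum u #{x ∈ T | x < s} {x ∈ T | x < s} *
            occupancySum u #{x ∈ T | s < x} {x ∈ T | s < x}) := by
      rcases hb : #{x ∈ T | s < x} with _ | b
      · rw [Nat.choose_eq_zero_of_lt (by omega)]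
        rw [card_eq_zero] at hb
        simp [hb]
      · rw [occupancySum, mul_sum, mul_sum]
        refine sum_congr rfl fun h hh => ?_
        have hh' := mem_filter.1 hh
        have e1 : {x ∈ T.erase h | s < x} = {x ∈ T | s < x}.erase h := by
          ext; simp only [mem_filter, mem_erase]; tauto
        have e2 : {x ∈ T.erase h | x < s} = {x ∈ T | x < s} := by
          ext; simp only [mem_filter, mem_erase]; grind
        rw [ih (T.erase h) (by simp [hs]) (by rw [card_erase_of_mem hh'.1, hT]; rfl), e1, e2,
          card_erase_of_mem hh, hb, ← e1, runLength_filter_gt (by simp [hs]) hh'.2,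
          Nat.add_sub_cancel]
        ring
    rw [occupancySum, hsplit, hl, hr]
    ring

lemma occupancySum_Ico_succ {R : Type*} [CommRing R] (u : R) (n a : ℕ) (ha : 1 ≤ a) :
    occupancySum u (n + 1) (Ico a (a + (n + 1))) =
      ∑ k ∈ range (n + 1), (n.choose k : R) * ((u + k) * (occupancySum u k (Ico a (a + k)) *
        occupancySum u (n - k) (Ico (a + k + 1) (a + k + 1 + (n - k))))) := by
  rw [occupancySum, sum_Ico_eq_sum_range, Nat.add_sub_cancel_left]
  refine sum_congr rfl fun k hk => ?_
  rw [mem_range] at hk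
  have hrun : runLength ((Ico a (a + (n + 1))).erase (a + k)) (a + k) = k := by
    have : {p ∈ Ico 1 (a + k) | Ico p (a + k) ⊆ (Ico a (a + (n + 1))).erase (a + k)} =
        Ico a (a + k) := by
      ext p
      simp only [mem_filter, mem_Ico, subset_iff, mem_erase]
      constructor
      · rintro ⟨h1, h2⟩
        have := (h2 (x := p) (by omega)).2
        omega
      · intro h
        refine ⟨by omega, fun x hx => by omega⟩
    rw [runLength, this, Nat.card_Ico, Nat.add_sub_cancel_left]
  have el : {x ∈ (Ico a (a + (n + 1))).erase (a + k) | x < a + k} = Ico a (a + k) := by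
    ext; simp only [mem_filter, mem_erase, mem_Ico]; omega
  have er : {x ∈ (Ico a (a + (n + 1))).erase (a + k) | a + k < x} =
      Ico (a + k + 1) (a + k + 1 + (n - k)) := by
    ext; simp only [mem_filter, mem_erase, mem_Ico]; omega
  rw [hrun, occupancySum_split u n _ (a + k) (by simp)
    (by rw [card_erase_of_mem (by simp; omega), Nat.card_Ico]; omega), el, er]
  simp only [Nat.card_Ico, Nat.add_sub_cancel_left]
  ring

lemma occupancySum_Ico_translate {R : Type*} [CommRing R] (u : R) (n a : ℕ) (ha : 1 ≤ a) :
    occupancySum u n (Ico a (a + n)) = occupancySum u n (Ico 1 (1 + n)) := by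
  induction n using Nat.strong_induction_on generalizing a with
  | _ n ih =>
    rcases n with _ | n
    · simp
    · rw [occupancySum_Ico_succ u n a ha, occupancySum_Ico_succ u n 1 le_rfl]
      refine sum_congr rfl fun k hk => ?_
      rw [mem_range] at hk
      rw [ih k hk a ha, ih (n - k) (by omega) _ (by omega),
        ih (n - k) (by omega) (1 + k + 1) (by omega)]

end Occupancy

section Parking

open Finset

lemma PA_mem {n : ℕ} (p : Fin n → ℕ) (i : Fin n) :
    p i ≤ PA p i ∧ ∀ j : Fin n, j < i → PA p j ≠ PA p i := by
  have hne : {s : ℕ | p i ≤ s ∧ ∀ j : Fin n, j < i → PA p j ≠ s}.Nonempty := by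
    obtain ⟨s, hs⟩ := Infinite.exists_notMem_finset (univ.image (PA p) ∪ range (p i))
    simp only [mem_union, mem_image, mem_univ, true_and, mem_range, not_or, not_exists,
      not_lt] at hs
    exact ⟨s, hs.2, fun j _ => hs.1 j⟩
  have := Nat.sInf_mem hne
  rwa [← PA] at this

lemma PA_injective {n : ℕ} (p : Fin n → ℕ) : Function.Injective (PA p) := by
  intro i j h
  rcases lt_trichotomy i j with hij | hij | hij
  · exact absurd h ((PA_mem p j).2 i hij)
  · exact hij
  · exact absurd h.symm ((PA_mem p i).2 j hij)

lemma PA_eq_iff {n : ℕ} (p : Fin n → ℕ) (i : Fin n) (h : ℕ) :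
    PA p i = h ↔ (p i ≤ h ∧ ∀ j < i, PA p j ≠ h) ∧
      ∀ s ∈ Ico (p i) h, ∃ j < i, PA p j = s := by
  constructor
  · rintro rfl
    refine ⟨PA_mem p i, fun s hs => ?_⟩
    rw [mem_Ico] at hs
    by_contra! hc
    have := Nat.sInf_le (s := {s : ℕ | p i ≤ s ∧ ∀ j : Fin n, j < i → PA p j ≠ s}) ⟨hs.1, hc⟩
    rw [← PA] at this
    omega
  · rintro ⟨h1, h2⟩
    refine le_antisymm ?_ ?_
    · rw [PA]
      exact Nat.sInf_le h1
    · by_contra! hc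
      obtain ⟨j, hj, e⟩ := h2 _ (mem_Ico.2 ⟨(PA_mem p i).1, hc⟩)
      exact (PA_mem p i).2 j hj e

lemma PA_snoc_castSucc {k : ℕ} (p : Fin k → ℕ) (x : ℕ) (i : Fin k) :
    PA (Fin.snoc p x : Fin (k + 1) → ℕ) i.castSucc = PA p i := by
  induction i using WellFoundedLT.induction with
  | _ i ih =>
    conv_lhs => rw [PA]
    conv_rhs => rw [PA]
    congr 1
    ext s
    simp only [Set.mem_ofPred_eq, Fin.snoc_castSucc]
    refine and_congr_right fun _ => ⟨fun H j hj => ?_, fun H j hj => ?_⟩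
    · rw [← ih j hj]
      exact H _ (Fin.castSucc_lt_castSucc_iff.2 hj)
    · obtain ⟨j, rfl⟩ := Fin.exists_castSucc_eq.2 (Fin.ne_last_of_lt hj)
      have hj' := Fin.castSucc_lt_castSucc_iff.1 hj
      rw [ih j hj']
      exact H j hj'

lemma image_PA_snoc {k : ℕ} (p : Fin k → ℕ) (x : ℕ) :
    univ.image (PA (Fin.snoc p x : Fin (k + 1) → ℕ)) =
      insert (PA (Fin.snoc p x : Fin (k + 1) → ℕ) (Fin.last k)) (univ.image (PA p)) := by
  ext s
  simp only [mem_image, mem_univ, true_and, mem_insert, Fin.exists_fin_succ', PA_snoc_castSucc]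
  rw [or_comm, eq_comm]

lemma PA_snoc_last_notMem {k : ℕ} (p : Fin k → ℕ) (x : ℕ) :
    PA (Fin.snoc p x : Fin (k + 1) → ℕ) (Fin.last k) ∉ univ.image (PA p) := by
  simp only [mem_image, mem_univ, true_and, not_exists]
  intro i hi
  rw [← PA_snoc_castSucc p x] at hi
  exact (Fin.castSucc_lt_last i).ne (PA_injective _ hi)

lemma PA_snoc_last_eq_iff {k : ℕ} (p : Fin k → ℕ) (x h : ℕ) (hh : h ∉ univ.image (PA p)) :
    PA (Fin.snoc p x : Fin (k + 1) → ℕ) (Fin.last k) = h ↔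
      x ≤ h ∧ Ico x h ⊆ univ.image (PA p) := by
  have key : ∀ s, (∃ j < Fin.last k, PA (Fin.snoc p x : Fin (k + 1) → ℕ) j = s) ↔
      s ∈ univ.image (PA p) := by
    intro s
    simp only [mem_image, mem_univ, true_and]
    constructor
    · rintro ⟨j, hj, e⟩
      obtain ⟨j, rfl⟩ := Fin.exists_castSucc_eq.2 hj.ne
      exact ⟨j, by rwa [PA_snoc_castSucc] at e⟩
    · rintro ⟨j, e⟩
      exact ⟨j.castSucc, Fin.castSucc_lt_last j, by rwa [PA_snoc_castSucc]⟩
  rw [PA_eq_iff, Fin.snoc_last]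
  simp only [key]
  have : ∀ j < Fin.last k, PA (Fin.snoc p x : Fin (k + 1) → ℕ) j ≠ h :=
    fun j hj e => hh ((key h).1 ⟨j, hj, e⟩)
  simp only [subset_iff]
  tauto

lemma pow_lucky {R : Type*} [CommRing R] (u : R) {n : ℕ} (p : Fin n → ℕ) :
    u ^ lucky p = ∏ c, if jumpAt p c = 0 then u else 1 := by
  rw [prod_ite, prod_const_one, mul_one, prod_const, lucky, Set.ncard_eq_toFinset_card']
  simp

lemma pow_lucky_snoc {R : Type*} [CommRing R] (u : R) {k : ℕ} (p : Fin k → ℕ) (x : ℕ) :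
    u ^ lucky (Fin.snoc p x : Fin (k + 1) → ℕ) = u ^ lucky p *
      if PA (Fin.snoc p x : Fin (k + 1) → ℕ) (Fin.last k) = x then u else 1 := by
  simp only [pow_lucky, Fin.prod_univ_castSucc, jumpAt, PA_snoc_castSucc, Fin.snoc_castSucc,
    Fin.snoc_last]
  have := (PA_mem (Fin.snoc p x : Fin (k + 1) → ℕ) (Fin.last k)).1
  rw [Fin.snoc_last] at this
  congr 1
  exact if_congr (by omega) rfl rfl

lemma sum_last_preference {R : Type*} [CommRing R] (u : R) (N : ℕ) (T : Finset ℕ) (h : ℕ)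
    (h1 : 1 ≤ h) (hN : h ≤ N) :
    ∑ x ∈ Icc 1 N, (if x ≤ h ∧ Ico x h ⊆ T then (if h = x then u else 1) else 0) =
      u + runLength T h := by
  rw [← add_sum_erase _ _ (mem_Icc.2 ⟨h1, hN⟩)]
  congr 1
  · simp
  · rw [runLength, card_filter, Nat.cast_sum, ← sum_subset (s₁ := Ico 1 h)]
    · refine sum_congr rfl fun x hx => ?_
      rw [mem_Ico] at hx
      rw [if_neg (by omega : h ≠ x)]
      simp [hx.2.le]
    · intro x hx
      simp only [mem_Ico, mem_erase, mem_Icc] at hx ⊢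
      omega
    · intro x hx hx'
      simp only [mem_Ico, mem_erase, mem_Icc] at hx hx'
      rw [if_neg (by omega)]

/-- Preference lists of `k` cars with values in `{1, ..., N}`. -/
def prefLists (k N : ℕ) : Finset (Fin k → ℕ) := Fintype.piFinset fun _ => Icc 1 N

lemma sum_prefLists_succ {R : Type*} [CommRing R] (k N : ℕ) (f : (Fin (k + 1) → ℕ) → R) :
    ∑ p ∈ prefLists (k + 1) N, f p =
      ∑ p ∈ prefLists k N, ∑ x ∈ Icc 1 N, f (Fin.snoc p x) := by
  rw [← sum_product']
  symm
  refine sum_bij' (fun y _ => (Fin.snoc y.1 y.2 : Fin (k + 1) → ℕ))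
    (fun p _ => (Fin.init p, p (Fin.last k))) ?_ ?_ ?_ ?_ ?_
  · rintro ⟨p, x⟩ h
    simp only [prefLists, mem_product, Fintype.mem_piFinset] at h ⊢
    intro i
    refine Fin.lastCases ?_ (fun i => ?_) i
    · simpa using h.2
    · simpa using h.1 i
  · intro p h
    simp only [prefLists, mem_product, Fintype.mem_piFinset] at h ⊢
    exact ⟨fun i => h i.castSucc, h _⟩
  · rintro ⟨p, x⟩ _
    simp
  · intro p _
    simp
  · simp

lemma sum_pow_lucky_eq_occupancySum {R : Type*} [CommRing R] (u : R) (k N : ℕ) (T : Finset ℕ)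
    (hT : T ⊆ Icc 1 N) :
    ∑ p ∈ prefLists k N with univ.image (PA p) = T, u ^ lucky p = occupancySum u k T := by
  induction k generalizing T with
  | zero =>
    rw [sum_filter]
    simp [prefLists, occupancySum, pow_lucky, eq_comm]
  | succ k ih =>
    rw [sum_filter, sum_prefLists_succ, occupancySum]
    have step : ∀ p : Fin k → ℕ, ∀ x : ℕ,
        (if univ.image (PA (Fin.snoc p x : Fin (k + 1) → ℕ)) = T then
          u ^ lucky (Fin.snoc p x : Fin (k + 1) → ℕ) else 0) =
        ∑ h ∈ T, if univ.image (PA p) = T.erase h then u ^ lucky p *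
          (if x ≤ h ∧ Ico x h ⊆ T.erase h then (if h = x then u else 1) else 0) else 0 := by
      intro p x
      have hnot := PA_snoc_last_notMem p x
      rw [image_PA_snoc, pow_lucky_snoc]
      set q := PA (Fin.snoc p x : Fin (k + 1) → ℕ) (Fin.last k) with hq
      have hterm : ∀ h ∈ T, (if univ.image (PA p) = T.erase h then u ^ lucky p *
          (if x ≤ h ∧ Ico x h ⊆ T.erase h then (if h = x then u else 1) else 0) else 0) =
          if h = q then (if univ.image (PA p) = T.erase h then u ^ lucky p *
            (if q = x then u else 1) else 0) else 0 := by
        intro h hh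
        by_cases hi : univ.image (PA p) = T.erase h
        · have := PA_snoc_last_eq_iff p x h (by rw [hi]; simp)
          rw [← hq, hi] at this
          simp only [if_pos hi, ← this]
          by_cases hqh : q = h
          · simp [hqh]
          · simp [hqh, Ne.symm hqh]
        · simp [hi]
      rw [sum_congr rfl hterm, sum_ite_eq']
      by_cases hqT : q ∈ T
      · rw [if_pos hqT]
        refine if_congr ?_ rfl rfl
        constructor
        · intro e
          rw [← e, erase_insert hnot]
        · intro e
          rw [e, insert_erase hqT]
      · rw [if_neg hqT, if_neg]
        rintro rfl
        exact hqT (mem_insert_self _ _)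
    simp only [step]
    rw [sum_congr rfl fun p _ => sum_comm, sum_comm]
    refine sum_congr rfl fun h hh => ?_
    have hh' := mem_Icc.1 (hT hh)
    rw [← ih (T.erase h) ((erase_subset _ _).trans hT), mul_comm, sum_mul, sum_filter]
    refine sum_congr rfl fun p _ => ?_
    split_ifs
    · rw [← mul_sum, sum_last_preference u N _ h hh'.1 hh'.2]
    · simp

lemma isParkingFunction_iff {n : ℕ} (p : Fin n → ℕ) :
    IsParkingFunction p ↔ p ∈ prefLists n n ∧ univ.image (PA p) = Icc 1 n := by
  simp only [IsParkingFunction, prefLists, Fintype.mem_piFinset, mem_Icc]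
  refine and_congr_right fun hp => ⟨fun h => ?_, fun h i => ?_⟩
  · refine eq_of_subset_of_card_le ?_ ?_
    · intro s hs
      obtain ⟨i, -, rfl⟩ := mem_image.1 hs
      exact mem_Icc.2 ⟨(hp i).1.trans (PA_mem p i).1, h i⟩
    · rw [card_image_of_injective _ (PA_injective p)]
      simp
  · have : PA p i ∈ univ.image (PA p) := mem_image_of_mem _ (mem_univ i)
    rw [h, mem_Icc] at this
    exact this.2

lemma sum_parkingFunction_eq_occupancySum {R : Type*} [CommRing R] (u : R) (n : ℕ) :
    ∑ P : ParkingFunction n, u ^ lucky P.1 = occupancySum u n (Ico 1 (1 + n)) := by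
  have hI : Ico 1 (1 + n) = Icc 1 n := by
    ext; simp only [mem_Ico, mem_Icc]; omega
  rw [hI, ← sum_pow_lucky_eq_occupancySum u n n _ subset_rfl]
  refine sum_bij (fun P _ => P.1) ?_ ?_ ?_ ?_
  · intro P _
    rw [mem_filter]
    exact (isParkingFunction_iff P.1).1 P.2
  · intro P _ Q _ h
    exact Subtype.ext h
  · intro p hp
    exact ⟨⟨p, (isParkingFunction_iff p).2 (mem_filter.1 hp)⟩, mem_univ _, rfl⟩
  · intro P _
    rfl

end Parking

section ParentMaps

open Finset

variable {β : Type*}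

/-- Iterating `f` from `x` eventually visits `v`. -/
def Reaches (f : β → β) (x v : β) : Prop := ∃ k : ℕ, f^[k] x = v

lemma Reaches.refl (f : β → β) (x : β) : Reaches f x x := ⟨0, rfl⟩

lemma Reaches.head {f : β → β} {x v : β} (h : Reaches f (f x) v) : Reaches f x v := by
  obtain ⟨k, hk⟩ := h
  exact ⟨k + 1, by rwa [Function.iterate_succ_apply]⟩

lemma Reaches.trans {f : β → β} {x y v : β} (h : Reaches f x y) (h' : Reaches f y v) :
    Reaches f x v := by
  obtain ⟨k, rfl⟩ := h
  obtain ⟨l, rfl⟩ := h'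
  exact ⟨l + k, by rw [Function.iterate_add_apply]⟩

lemma Reaches.head_induction {f : β → β} {v : β} {P : β → Prop} {x : β} (h : Reaches f x v)
    (refl : P v) (head : ∀ x, Reaches f (f x) v → P (f x) → P x) : P x := by
  obtain ⟨k, hk⟩ := h
  induction k generalizing x with
  | zero => rwa [← hk] at refl
  | succ k ih =>
    rw [Function.iterate_succ_apply] at hk
    exact head x ⟨k, hk⟩ (ih hk)

lemma Reaches.mem_of_invariant {f : β → β} {v x : β} {D : β → Prop} (h : Reaches f x v)
    (hD : ∀ x, ¬ D x → ¬ D (f x)) (hv : D v) : D x :=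
  h.head_induction hv fun x _ hx => by
    by_contra hc
    exact hD x hc hx

lemma Reaches.congr {f g : β → β} {v x : β} {D : β → Prop} (h : Reaches f x v)
    (hD : ∀ x, ¬ D x → ¬ D (f x)) (hv : D v) (hfg : ∀ x, D x → f x = g x) : Reaches g x v :=
  h.head_induction (P := fun x => Reaches g x v) (Reaches.refl g v) fun x h' hx => by
    have hx' : D x := (Reaches.head h').mem_of_invariant hD hv
    rw [hfg x hx'] at hx
    exact hx.head

lemma Reaches.eq_of_fixed {f : β → β} {x v : β} (h : Reaches f x v) (hx : f x = x) : x = v := by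
  obtain ⟨k, rfl⟩ := h
  rw [Function.iterate_fixed hx]

lemma Reaches.eq_of_map_eq_fixed {f : β → β} {x r r' z : β} (hz : f z = z)
    (h : Reaches f x r) (h' : Reaches f x r') (hr : f r = z) (hr' : f r' = z)
    (hrz : r ≠ z) (hrz' : r' ≠ z) : r = r' := by
  revert h'
  refine h.head_induction (P := fun x => Reaches f x r' → r = r') ?_ ?_
  · rintro ⟨_ | k, hk⟩
    · exact hk
    · rw [Function.iterate_succ_apply, hr, Function.iterate_fixed hz] at hk
      exact absurd hk.symm hrz'
  · rintro x hx ih ⟨_ | k, hk⟩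
    · rw [Function.iterate_zero_apply] at hk
      rw [hk, hr'] at hx
      exact absurd (hx.eq_of_fixed hz).symm hrz
    · exact ih ⟨k, hk⟩

/-- `f` is the parent map of a forest on the vertex set `S` whose roots are attached to `z`. -/
def IsParentMap (S : Finset β) (z : β) (f : β → β) : Prop :=
  (∀ v ∉ S, f v = v) ∧ ∀ v ∈ S, Reaches f v z

lemma IsParentMap.map_mem {S : Finset β} {z : β} {f : β → β} (hf : IsParentMap S z f)
    (hz : z ∉ S) {v : β} (hv : v ∈ S) (hne : f v ≠ z) : f v ∈ S := by
  by_contra hc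
  obtain ⟨_ | k, hk⟩ := hf.2 v hv
  · exact hz (by rwa [← hk])
  · rw [Function.iterate_succ_apply, Function.iterate_fixed (hf.1 _ hc)] at hk
    exact hne hk

lemma IsParentMap.not_mem_of_not_mem {S : Finset β} {z : β} {f : β → β} (hf : IsParentMap S z f)
    (x : β) (hx : x ∉ S) : f x ∉ S := by
  rwa [hf.1 x hx]

/-- The vertex `v` has no smaller descendant. -/
def IsLeader [LinearOrder β] (f : β → β) (v : β) : Prop := ∀ x, Reaches f x v → v ≤ x

variable [LinearOrder β]

/-- The parent map obtained from a forest `f₁` on `C \ {r}` and a forest `f₂` off `C`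
by making `r` the parent of the roots of `f₁` and `z` the parent of `r`. -/
def gluedMap (C : Finset β) (r z : β) (f₁ f₂ : β → β) (v : β) : β :=
  if v = r then z else if v ∈ C then f₁ v else f₂ v

section Glue

variable {S C : Finset β} {r z : β} {f₁ f₂ : β → β}

lemma gluedMap_root : gluedMap C r z f₁ f₂ r = z := if_pos rfl

lemma gluedMap_of_mem_erase {v : β} (hv : v ∈ C.erase r) : gluedMap C r z f₁ f₂ v = f₁ v := by
  rw [mem_erase] at hv
  rw [gluedMap, if_neg hv.1, if_pos hv.2]

lemma gluedMap_of_notMem (hr : r ∈ C) {v : β} (hv : v ∉ C) : gluedMap C r z f₁ f₂ v = f₂ v := by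
  rw [gluedMap, if_neg (ne_of_mem_of_not_mem hr hv).symm, if_neg hv]

lemma gluedMap_notMem (hCS : C ⊆ S) (hr : r ∈ C) (hz : z ∉ S)
    (h₂ : IsParentMap (S \ C) z f₂) (x : β) (hx : x ∉ C) : gluedMap C r z f₁ f₂ x ∉ C := by
  rw [gluedMap_of_notMem hr hx]
  by_cases hxS : x ∈ S
  · by_cases e : f₂ x = z
    · rw [e]
      exact fun h => hz (hCS h)
    · exact (mem_sdiff.1 (h₂.map_mem (by simp [hz]) (mem_sdiff.2 ⟨hxS, hx⟩) e)).2
  · rwa [h₂.1 x (by simp [hxS])]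

lemma reaches_gluedMap_root_iff (hCS : C ⊆ S) (hr : r ∈ C) (hz : z ∉ S)
    (h₁ : IsParentMap (C.erase r) r f₁) (h₂ : IsParentMap (S \ C) z f₂)
    (x : β) : Reaches (gluedMap C r z f₁ f₂) x r ↔ x ∈ C := by
  refine ⟨fun h => h.mem_of_invariant (D := (· ∈ C)) (gluedMap_notMem hCS hr hz h₂) hr,
    fun hx => ?_⟩
  by_cases hxr : x = r
  · rw [hxr]
    exact Reaches.refl _ _
  have hreach := h₁.2 x (mem_erase.2 ⟨hxr, hx⟩)
  refine hreach.head_induction (P := fun x => Reaches (gluedMap C r z f₁ f₂) x r)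
    (Reaches.refl _ _) fun y hy ih => ?_
  by_cases hyC : y ∈ C.erase r
  · rw [← gluedMap_of_mem_erase (z := z) (f₁ := f₁) (f₂ := f₂) hyC] at ih
    exact ih.head
  · rwa [h₁.1 y hyC] at ih

lemma isParentMap_gluedMap (hCS : C ⊆ S) (hr : r ∈ C) (hz : z ∉ S)
    (h₁ : IsParentMap (C.erase r) r f₁) (h₂ : IsParentMap (S \ C) z f₂) :
    IsParentMap S z (gluedMap C r z f₁ f₂) := by
  refine ⟨fun v hv => ?_, fun v hv => ?_⟩
  · rw [gluedMap_of_notMem hr (fun h => hv (hCS h)), h₂.1 v (by simp [hv])]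
  by_cases hvC : v ∈ C
  · exact ((reaches_gluedMap_root_iff hCS hr hz h₁ h₂ v).2 hvC).trans
      ⟨1, by simp [gluedMap_root]⟩
  · have key := (h₂.2 v (mem_sdiff.2 ⟨hv, hvC⟩)).head_induction
      (P := fun x => x ∉ C → Reaches (gluedMap C r z f₁ f₂) x z)
      (fun _ => Reaches.refl _ _) fun x _ ih hx => ?_
    · exact key hvC
    · rw [← gluedMap_of_notMem (z := z) (f₁ := f₁) (f₂ := f₂) hr hx] at ih
      exact (ih (gluedMap_notMem hCS hr hz h₂ x hx)).head

lemma isLeader_gluedMap_of_mem_erase (hCS : C ⊆ S) (hr : r ∈ C) (hz : z ∉ S)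
    (h₁ : IsParentMap (C.erase r) r f₁) (h₂ : IsParentMap (S \ C) z f₂)
    {v : β} (hv : v ∈ C.erase r) :
    IsLeader (gluedMap C r z f₁ f₂) v ↔ IsLeader f₁ v := by
  refine forall_congr' fun x => imp_congr_left ⟨fun h => ?_, fun h => ?_⟩
  · refine h.congr (D := (· ∈ C.erase r)) (fun y hy => ?_) hv
      fun y hy => gluedMap_of_mem_erase hy
    by_cases hyC : y ∈ C
    · obtain rfl : y = r := by_contra fun h => hy (mem_erase.2 ⟨h, hyC⟩)
      rw [gluedMap_root]
      exact fun h => hz (hCS (mem_of_mem_erase h))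
    · exact fun h => gluedMap_notMem hCS hr hz h₂ y hyC (mem_of_mem_erase h)
  · exact h.congr (D := (· ∈ C.erase r)) h₁.not_mem_of_not_mem hv
      fun y hy => (gluedMap_of_mem_erase hy).symm

lemma isLeader_gluedMap_of_mem_sdiff (hr : r ∈ C) (hz : z ∉ S)
    (h₁ : IsParentMap (C.erase r) r f₁) (h₂ : IsParentMap (S \ C) z f₂)
    {v : β} (hv : v ∈ S \ C) :
    IsLeader (gluedMap C r z f₁ f₂) v ↔ IsLeader f₂ v := by
  refine forall_congr' fun x => imp_congr_left ⟨fun h => ?_, fun h => ?_⟩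
  · refine h.congr (D := (· ∈ S \ C)) (fun y hy => ?_) hv
      fun y hy => gluedMap_of_notMem hr (mem_sdiff.1 hy).2
    by_cases hyC : y ∈ C.erase r
    · rw [gluedMap_of_mem_erase hyC]
      by_cases e : f₁ y = r
      · simp [e, hr]
      · have := h₁.map_mem (by simp) hyC e
        simp [mem_of_mem_erase this]
    · by_cases e : y = r
      · rw [e, gluedMap_root]
        simp [hz]
      · have hyC' : y ∉ C := fun h => hyC (mem_erase.2 ⟨e, h⟩)
        rwa [gluedMap_of_notMem hr hyC', h₂.1 y hy]
  · exact h.congr (D := (· ∈ S \ C)) h₂.not_mem_of_not_mem hv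
      fun y hy => (gluedMap_of_notMem hr (mem_sdiff.1 hy).2).symm

lemma isLeader_gluedMap_root (hCS : C ⊆ S) (hr : r ∈ C) (hz : z ∉ S)
    (h₁ : IsParentMap (C.erase r) r f₁) (h₂ : IsParentMap (S \ C) z f₂)
    {m : β} (hm : m ∈ C) (hmin : ∀ x ∈ S, m ≤ x) :
    IsLeader (gluedMap C r z f₁ f₂) r ↔ r = m := by
  constructor
  · intro h
    exact le_antisymm (h m ((reaches_gluedMap_root_iff hCS hr hz h₁ h₂ m).2 hm))
      (hmin r (hCS hr))
  · rintro rfl x hx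
    exact hmin x (hCS ((reaches_gluedMap_root_iff hCS hr hz h₁ h₂ x).1 hx))

end Glue

/-- Every forest is glued from the tree containing a given vertex and the other trees. -/
lemma IsParentMap.exists_gluedMap {S : Finset β} {z m : β} {f : β → β}
    (hf : IsParentMap S z f) (hz : z ∉ S) (hm : m ∈ S) :
    ∃ (C : Finset β) (r : β) (f₁ f₂ : β → β), C ⊆ S ∧ m ∈ C ∧ r ∈ C ∧
      IsParentMap (C.erase r) r f₁ ∧ IsParentMap (S \ C) z f₂ ∧ gluedMap C r z f₁ f₂ = f := by
  classical
  obtain ⟨r, hrS, hmr, hrz⟩ : ∃ r ∈ S, Reaches f m r ∧ f r = z := by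
    refine (hf.2 m hm).head_induction (P := fun x => x ∈ S → ∃ r ∈ S, Reaches f x r ∧ f r = z)
      (fun h => absurd h hz) (fun x _ ih hx => ?_) hm
    by_cases e : f x = z
    · exact ⟨x, hx, Reaches.refl _ _, e⟩
    · obtain ⟨r, hr, h1, h2⟩ := ih (hf.map_mem hz hx e)
      exact ⟨r, hr, h1.head, h2⟩
  have hsub : ∀ x, Reaches f x r → x ∈ S := fun x hx =>
    hx.mem_of_invariant (D := (· ∈ S)) hf.not_mem_of_not_mem hrS
  set C : Finset β := {x ∈ S | Reaches f x r} with hC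
  have hmemC : ∀ x, x ∈ C ↔ Reaches f x r := fun x => by
    rw [hC, mem_filter]
    exact ⟨And.right, fun h => ⟨hsub x h, h⟩⟩
  refine ⟨C, r, fun v => if v ∈ C.erase r then f v else v, fun v => if v ∈ S \ C then f v else v,
    filter_subset _ _, (hmemC m).2 hmr, (hmemC r).2 (Reaches.refl _ _),
    ⟨fun v hv => if_neg hv, fun v hv => ?_⟩, ⟨fun v hv => if_neg hv, fun v hv => ?_⟩, ?_⟩
  · refine ((hmemC v).1 (mem_of_mem_erase hv)).head_induction
      (P := fun x => Reaches (fun v => if v ∈ C.erase r then f v else v) x r)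
      (Reaches.refl _ _) fun x hx ih => ?_
    by_cases e : x = r
    · rw [e]
      exact Reaches.refl _ _
    · refine Reaches.head ?_
      rwa [if_pos (mem_erase.2 ⟨e, (hmemC x).2 hx.head⟩)]
  · rw [mem_sdiff] at hv
    refine (hf.2 v hv.1).head_induction
      (P := fun x => x ∉ C → Reaches (fun v => if v ∈ S \ C then f v else v) x z)
      (fun _ => Reaches.refl _ _) (fun x _ ih hx => ?_) hv.2
    have hfx : f x ∉ C := fun h => hx ((hmemC x).2 ((hmemC _).1 h).head)
    by_cases hxS : x ∈ S
    · refine Reaches.head ?_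
      rw [if_pos (mem_sdiff.2 ⟨hxS, hx⟩)]
      exact ih hfx
    · have := ih hfx
      rwa [hf.1 x hxS] at this
  · funext v
    by_cases e : v = r
    · rw [e, gluedMap_root, hrz]
    · by_cases hvC : v ∈ C
      · have : v ∈ C.erase r := mem_erase.2 ⟨e, hvC⟩
        rw [gluedMap_of_mem_erase this, if_pos this]
      · rw [gluedMap_of_notMem ((hmemC r).2 (Reaches.refl _ _)) hvC]
        by_cases hvS : v ∈ S
        · rw [if_pos (mem_sdiff.2 ⟨hvS, hvC⟩)]
        · rw [if_neg (by simp [hvS]), hf.1 v hvS]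

lemma gluedMap_injective {S C C' : Finset β} {r r' z m : β} {f₁ f₂ f₁' f₂' : β → β} (hz : z ∉ S)
    (hCS : C ⊆ S) (hm : m ∈ C) (hr : r ∈ C) (h₁ : IsParentMap (C.erase r) r f₁)
    (h₂ : IsParentMap (S \ C) z f₂)
    (hCS' : C' ⊆ S) (hm' : m ∈ C') (hr' : r' ∈ C') (h₁' : IsParentMap (C'.erase r') r' f₁')
    (h₂' : IsParentMap (S \ C') z f₂')
    (h : gluedMap C r z f₁ f₂ = gluedMap C' r' z f₁' f₂') :
    C = C' ∧ r = r' ∧ f₁ = f₁' ∧ f₂ = f₂' := by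
  have hroot := reaches_gluedMap_root_iff hCS hr hz h₁ h₂
  have hroot' := reaches_gluedMap_root_iff hCS' hr' hz h₁' h₂'
  rw [← h] at hroot'
  have hrr : r = r' := Reaches.eq_of_map_eq_fixed
    ((isParentMap_gluedMap hCS hr hz h₁ h₂).1 z hz) ((hroot m).2 hm) ((hroot' m).2 hm')
    gluedMap_root (by rw [h, gluedMap_root]) (fun e => hz (hCS (e ▸ hr)))
    (fun e => hz (hCS' (e ▸ hr')))
  subst hrr
  have hCC : C = C' := by
    ext x
    rw [← hroot, hroot']
  subst hCC
  refine ⟨rfl, rfl, funext fun v => ?_, funext fun v => ?_⟩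
  · by_cases hv : v ∈ C.erase r
    · rw [← gluedMap_of_mem_erase (z := z) (f₁ := f₁) (f₂ := f₂) hv, h, gluedMap_of_mem_erase hv]
    · rw [h₁.1 v hv, h₁'.1 v hv]
  · by_cases hv : v ∈ S \ C
    · have := (mem_sdiff.1 hv).2
      rw [← gluedMap_of_notMem (z := z) (f₁ := f₁) (f₂ := f₂) hr this, h, gluedMap_of_notMem hr this]
    · rw [h₂.1 v hv, h₂'.1 v hv]

open Classical in
/-- The weight of a forest on `S`: a factor `u` for each leader. -/
noncomputable def leaderWeight {R : Type*} [CommRing R] (u : R) (S : Finset β) (f : β → β) : R :=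
  ∏ v ∈ S, if IsLeader f v then u else 1

lemma leaderWeight_gluedMap {R : Type*} [CommRing R] (u : R) {S C : Finset β} {r z m : β}
    {f₁ f₂ : β → β} (hCS : C ⊆ S) (hr : r ∈ C) (hz : z ∉ S)
    (h₁ : IsParentMap (C.erase r) r f₁) (h₂ : IsParentMap (S \ C) z f₂)
    (hm : m ∈ C) (hmin : ∀ x ∈ S, m ≤ x) :
    leaderWeight u S (gluedMap C r z f₁ f₂) = (if r = m then u else 1) *
      (leaderWeight u (C.erase r) f₁ * leaderWeight u (S \ C) f₂) := by
  classical
  simp only [leaderWeight]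
  rw [← prod_sdiff hCS, ← mul_prod_erase C _ hr,
    prod_congr rfl fun v hv => if_congr (isLeader_gluedMap_of_mem_sdiff hr hz h₁ h₂ hv) rfl rfl,
    prod_congr rfl fun v hv => if_congr (isLeader_gluedMap_of_mem_erase hCS hr hz h₁ h₂ hv) rfl rfl,
    if_congr (isLeader_gluedMap_root hCS hr hz h₁ h₂ hm hmin) rfl rfl]
  ring

variable [Fintype β]

open Classical in
/-- The parent maps of forests on `S` with roots attached to `z`. -/
noncomputable def parentMaps (S : Finset β) (z : β) : Finset (β → β) := {f | IsParentMap S z f}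

lemma mem_parentMaps {S : Finset β} {z : β} {f : β → β} :
    f ∈ parentMaps S z ↔ IsParentMap S z f := by
  simp [parentMaps]

lemma sum_leaderWeight_eq {R : Type*} [CommRing R] (u : R) {S : Finset β} {z m : β} (hz : z ∉ S)
    (hm : m ∈ S) (hmin : ∀ x ∈ S, m ≤ x) :
    ∑ f ∈ parentMaps S z, leaderWeight u S f =
      ∑ A ∈ (S.erase m).powerset, ∑ r ∈ insert m A, (if r = m then u else 1) *
        ((∑ f ∈ parentMaps ((insert m A).erase r) r, leaderWeight u ((insert m A).erase r) f) *
          ∑ f ∈ parentMaps (S \ insert m A) z, leaderWeight u (S \ insert m A) f) := by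
  have hA : ∀ A ∈ (S.erase m).powerset, insert m A ⊆ S ∧ m ∉ A := by
    intro A h
    rw [mem_powerset] at h
    exact ⟨insert_subset hm (h.trans (erase_subset _ _)), fun h' => (notMem_erase m S) (h h')⟩
  simp only [sum_mul_sum, ← sum_product']
  simp only [mul_sum]
  rw [sum_sigma', sum_sigma']
  symm
  refine sum_bij (fun y _ => gluedMap (insert m y.1.1) y.1.2 z y.2.1 y.2.2) ?_ ?_ ?_ ?_
  · rintro ⟨⟨A, r⟩, f₁, f₂⟩ h
    simp only [mem_sigma, mem_product, mem_parentMaps] at h ⊢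
    exact isParentMap_gluedMap (hA A h.1.1).1 h.1.2 hz h.2.1 h.2.2
  · rintro ⟨⟨A, r⟩, f₁, f₂⟩ h ⟨⟨A', r'⟩, f₁', f₂'⟩ h' e
    simp only [mem_sigma, mem_product, mem_parentMaps] at h h' e
    obtain ⟨e1, rfl, rfl, rfl⟩ := gluedMap_injective hz (hA A h.1.1).1 (mem_insert_self _ _) h.1.2
      h.2.1 h.2.2 (hA A' h'.1.1).1 (mem_insert_self _ _) h'.1.2 h'.2.1 h'.2.2 e
    have : A = A' := by
      rw [← erase_insert (hA A h.1.1).2, e1, erase_insert (hA A' h'.1.1).2]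
    rw [this]
  · intro f hf
    obtain ⟨C, r, f₁, f₂, hCS, hmC, hr, h₁, h₂, e⟩ :=
      (mem_parentMaps.1 hf).exists_gluedMap hz hm
    have hC : insert m (C.erase m) = C := insert_erase hmC
    refine ⟨⟨⟨C.erase m, r⟩, f₁, f₂⟩, ?_, ?_⟩
    · simp only [mem_sigma, mem_product, mem_parentMaps, mem_powerset, hC]
      exact ⟨⟨erase_subset_erase _ hCS, hr⟩, h₁, h₂⟩
    · simp only [hC, e]
  · rintro ⟨⟨A, r⟩, f₁, f₂⟩ h
    simp only [mem_sigma, mem_product, mem_parentMaps] at h ⊢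
    rw [leaderWeight_gluedMap u (hA A h.1.1).1 h.1.2 hz h.2.1 h.2.2 (mem_insert_self _ _) hmin]

lemma sum_leaderWeight_eq_occupancySum {R : Type*} [CommRing R] (u : R) (n : ℕ) (S : Finset β)
    (z : β) (hz : z ∉ S) (hS : #S = n) :
    ∑ f ∈ parentMaps S z, leaderWeight u S f = occupancySum u n (Ico 1 (1 + n)) := by
  induction n using Nat.strong_induction_on generalizing S z with
  | _ n ih =>
    rcases n with _ | n
    · rw [card_eq_zero] at hS
      subst hS
      have : parentMaps ∅ z = {id} := by
        ext f
        simp [mem_parentMaps, IsParentMap, funext_iff]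
      simp [this, leaderWeight, occupancySum]
    · have hne : S.Nonempty := card_pos.1 (by omega)
      have hm := S.min'_mem hne
      have hmin : ∀ x ∈ S, S.min' hne ≤ x := fun x hx => S.min'_le x hx
      generalize S.min' hne = m at hm hmin
      have hcard : #(S.erase m) = n := by rw [card_erase_of_mem hm, hS]; rfl
      have hterm : ∀ A ∈ (S.erase m).powerset, (∑ r ∈ insert m A, (if r = m then u else 1) *
          ((∑ f ∈ parentMaps ((insert m A).erase r) r, leaderWeight u ((insert m A).erase r) f) *
            ∑ f ∈ parentMaps (S \ insert m A) z, leaderWeight u (S \ insert m A) f)) =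
          (u + (#A : R)) * (occupancySum u #A (Ico 1 (1 + #A)) *
            occupancySum u (n - #A) (Ico 1 (1 + (n - #A)))) := by
        intro A hA
        rw [mem_powerset] at hA
        have hmA : m ∉ A := fun h => notMem_erase m S (hA h)
        have hAn : #A ≤ n := hcard ▸ card_le_card hA
        have hI : #(insert m A) = #A + 1 := card_insert_of_notMem hmA
        have hIS : insert m A ⊆ S := insert_subset hm (hA.trans (erase_subset _ _))
        rw [ih (n - #A) (by omega) (S \ insert m A) z (by simp [hz])
          (by rw [card_sdiff_of_subset hIS, hI, hS]; omega)]
        rw [sum_congr rfl fun r hr => by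
          rw [ih #A (by omega) ((insert m A).erase r) r (by simp)
            (by rw [card_erase_of_mem hr, hI]; rfl)], ← sum_mul]
        congr 1
        rw [sum_insert hmA, if_pos rfl, sum_congr rfl fun r hr =>
          if_neg (fun e : r = m => hmA (e ▸ hr))]
        simp
      rw [sum_leaderWeight_eq u hz hm hmin, sum_congr rfl hterm,
        sum_powerset_apply_card (fun k => (u + (k : R)) * (occupancySum u k (Ico 1 (1 + k)) *
            occupancySum u (n - k) (Ico 1 (1 + (n - k))))), hcard,
        occupancySum_Ico_succ u n 1 le_rfl]
      refine sum_congr rfl fun k _ => ?_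
      rw [nsmul_eq_mul, occupancySum_Ico_translate u (n - k) (1 + k + 1) (by omega)]

end ParentMaps

section Forests

open Finset

/-- The parent function of a forest, with the roots attached to an additional vertex `⊤`. -/
def extendParent {n : ℕ} (par : Fin n → Option (Fin n)) : WithTop (Fin n) → WithTop (Fin n) :=
  fun o => Option.bind o par

lemma extendParent_top {n : ℕ} (par : Fin n → Option (Fin n)) : extendParent par ⊤ = ⊤ := rfl

lemma extendParent_coe {n : ℕ} (par : Fin n → Option (Fin n)) (v : Fin n) :
    extendParent par v = par v := rfl

lemma reaches_extendParent_iff {n : ℕ} (par : Fin n → Option (Fin n)) (x v : Fin n) :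
    Reaches (extendParent par) x v ↔ Descendant par v x := by
  constructor
  · intro h
    suffices ∀ y : Fin n, (x : WithTop (Fin n)) = y → Descendant par v y from this x rfl
    refine h.head_induction (P := fun o : WithTop (Fin n) => ∀ y : Fin n, o = y → Descendant par v y) ?_ ?_
    · intro y hy
      rw [WithTop.coe_inj.1 hy]
      exact Relation.ReflTransGen.refl
    · rintro _ ho ih y rfl
      rw [extendParent_coe] at ho ih
      rcases hp : par y with _ | w
      · rw [hp] at ho
        exact absurd (ho.eq_of_fixed (extendParent_top par)) (WithTop.coe_ne_top (a := v)).symm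
      · exact Relation.ReflTransGen.head hp (ih w hp)
  · intro h
    refine Relation.ReflTransGen.head_induction_on h (Reaches.refl _ _) fun {a b} hab _ ih => ?_
    refine Reaches.head ?_
    rw [extendParent_coe, hab]
    exact ih

lemma isForest_iff {n : ℕ} (par : Fin n → Option (Fin n)) :
    IsForest par ↔ IsParentMap (univ.erase ⊤) ⊤ (extendParent par) := by
  have hoff : ∀ v ∉ univ.erase (⊤ : WithTop (Fin n)), extendParent par v = v := by
    intro v hv
    obtain rfl : v = ⊤ := by simpa using hv
    rfl
  constructor
  · intro h
    refine ⟨hoff, fun o _ => ?_⟩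
    let r : Fin n → Fin n → Prop := fun w v => Relation.TransGen (fun a b => par a = some b) v w
    have : IsTrans (Fin n) r := ⟨fun a b c hab hbc => hbc.trans hab⟩
    have : Std.Irrefl r := ⟨h⟩
    have wf : WellFounded r := Finite.wellFounded_of_trans_of_irrefl r
    induction o using WithTop.recTopCoe with
    | top => exact Reaches.refl _ _
    | coe v =>
      induction v using wf.induction with
      | _ v ih =>
        refine Reaches.head ?_
        rw [extendParent_coe]
        rcases hp : par v with _ | w
        · exact Reaches.refl _ _
        · exact ih w (Relation.TransGen.single hp) (by simp)
  · intro h v hv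
    have hreach := h.2 v (by simp)
    suffices ∀ w : Fin n, (v : WithTop (Fin n)) = w →
      ¬ Relation.TransGen (fun a b => par a = some b) w w from this v rfl hv
    refine hreach.head_induction (P := fun o : WithTop (Fin n) => ∀ w : Fin n, o = w →
      ¬ Relation.TransGen (fun a b => par a = some b) w w) ?_ ?_
    · intro v hv
      exact absurd hv.symm WithTop.coe_ne_top
    · rintro _ - ih v rfl hv
      obtain ⟨w, hvw, hwv⟩ := Relation.TransGen.head'_iff.1 hv
      exact ih w hvw (Relation.TransGen.tail' hwv hvw)

lemma forestInvAt_eq_zero_iff {n : ℕ} (F : Forest n) (v : Fin n) :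
    forestInvAt F v = 0 ↔ IsLeader (extendParent F.1) (v : WithTop (Fin n)) := by
  rw [forestInvAt, Set.ncard_eq_zero, Set.eq_empty_iff_forall_notMem]
  simp only [Set.mem_ofPred_eq, not_and', not_lt, IsLeader, WithTop.forall, le_top, implies_true,
    true_and, WithTop.coe_le_coe, reaches_extendParent_iff]

lemma pow_forestLead {R : Type*} [CommRing R] (u : R) {n : ℕ} (F : Forest n) :
    u ^ forestLead F = leaderWeight u (univ.erase ⊤) (extendParent F.1) := by
  classical
  have hS : univ.erase (⊤ : WithTop (Fin n)) = univ.map Function.Embedding.coeWithTop := by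
    ext o
    induction o using WithTop.recTopCoe <;> simp
  rw [leaderWeight, hS, prod_map, prod_ite, prod_const_one, mul_one, prod_const, forestLead,
    Set.ncard_eq_toFinset_card']
  congr 2
  ext v
  simp [forestInvAt_eq_zero_iff]

lemma sum_forest_eq_occupancySum {R : Type*} [CommRing R] (u : R) (n : ℕ) :
    ∑ F : Forest n, u ^ forestLead F = occupancySum u n (Ico 1 (1 + n)) := by
  rw [← sum_leaderWeight_eq_occupancySum u n (univ.erase (⊤ : WithTop (Fin n))) ⊤ (by simp)
    (by
      rw [card_erase_of_mem (mem_univ _), card_univ]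
      exact congrArg (· - 1)
        (Fintype.card_option.trans (congrArg (· + 1) (Fintype.card_fin n))))]
  refine sum_bij (fun F _ => extendParent F.1) ?_ ?_ ?_ ?_
  · intro F _
    exact mem_parentMaps.2 ((isForest_iff F.1).1 F.2)
  · intro F _ F' _ h
    exact Subtype.ext (funext fun v => congrFun h (v : WithTop (Fin n)))
  · intro f hf
    rw [mem_parentMaps] at hf
    have e : extendParent (fun v : Fin n => f v) = f := by
      funext o
      induction o using WithTop.recTopCoe with
      | top => exact (hf.1 ⊤ (by simp)).symm
      | coe v => rfl
    exact ⟨⟨fun v => f v, (isForest_iff _).2 (by rwa [e])⟩, mem_univ _, e⟩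
  · intro F _
    exact pow_forestLead u F

end Forests

/-- `Σ_{F ∈ F_n} u^{lead F} = Σ_{P ∈ PF_n} u^{lucky P}`. -/
theorem sum_lead_eq_sum_lucky (n : ℕ) (hn : 1 ≤ n) (R : Type*) [CommRing R] (u : R) :
    ∑ F : Forest n, u ^ forestLead F = ∑ P : ParkingFunction n, u ^ lucky P.1 := by
  rw [sum_forest_eq_occupancySum, sum_parkingFunction_eq_occupancySum]
end

section
/- For every natural number n ≥ 1, there exists a bijection φ from the set F_n of rooted labeled forests on n vertices onto the set PF_n of parking functions of length n such that for every F ∈ F_n, writing φ(F) = (a_1,...,a_n), one has inv(F) = C(n+1, 2) − (a_1 + a_2 + ... + a_n) and lead(F) = lucky(φ(F)). -/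
/-! ### Forests supported on a finite set of vertices -/

/-- Forests on the vertex set `S`, as parent functions on the ambient type `Fin n`. -/
def forestsOn {n : ℕ} (S : Finset (Fin n)) : Set (Fin n → Option (Fin n)) :=
  {f | IsForest f ∧ ∀ v w, f v = some w → v ∈ S ∧ w ∈ S}

/-- The number of inversions `(v, x)` of a parent function. -/
noncomputable def invAt {n : ℕ} (f : Fin n → Option (Fin n)) (v : Fin n) : ℕ :=
  Set.ncard {x : Fin n | x < v ∧ Descendant f v x}

/-- The multiset of the numbers `inv(f : v)` for `v ∈ S`. -/
noncomputable def invMultiset {n : ℕ} (S : Finset (Fin n)) (f : Fin n → Option (Fin n)) :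
    Multiset ℕ :=
  S.val.map (invAt f)

/-- The number of elements of `T` smaller than `r`. -/
def rankIn {n : ℕ} (T : Finset (Fin n)) (r : Fin n) : ℕ := (T.filter (· < r)).card

/-- Data for splitting a structure on the set containing a marked element: a block `T`, an element
of the block, a structure on the block minus one element and a structure off the block. -/
structure SplitData (n : ℕ) (α : Type) where
  block : Finset (Fin n)
  root : Fin n
  inner : α
  outer : α

/-- The splittings of forests on `S` in which `m` lies in the block. -/
def forestSplits {n : ℕ} (S : Finset (Fin n)) (m : Fin n) :
    Set (SplitData n (Fin n → Option (Fin n))) :=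
  {d | d.block ⊆ S ∧ m ∈ d.block ∧ d.root ∈ d.block ∧
    d.inner ∈ forestsOn (d.block.erase d.root) ∧ d.outer ∈ forestsOn (S \ d.block)}

/-- Attach the inner forest to the root and add the outer forest. -/
def glueForest {n : ℕ} (d : SplitData n (Fin n → Option (Fin n))) (v : Fin n) :
    Option (Fin n) :=
  if v ∈ d.block then
    if v = d.root then none else some ((d.inner v).getD d.root)
  else d.outer v

section Forest

variable {n : ℕ} {S : Finset (Fin n)} {m : Fin n}

lemma exists_root {f : Fin n → Option (Fin n)} (hf : IsForest f) (x : Fin n) :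
    ∃ r, f r = none ∧ Descendant f r x := by
  let R : Fin n → Fin n → Prop := fun b a => Relation.TransGen (fun a b => f a = some b) a b
  have : IsTrans (Fin n) R := ⟨fun a b c h₁ h₂ => Relation.TransGen.trans h₂ h₁⟩
  have : Std.Irrefl R := ⟨fun a h => hf a h⟩
  have wf : WellFounded R := Finite.wellFounded_of_trans_of_irrefl R
  induction x using wf.induction with
  | _ x ih =>
    cases hx : f x with
    | none => exact ⟨x, hx, Relation.ReflTransGen.refl⟩
    | some y =>
      obtain ⟨r, hr, hd⟩ := ih y (Relation.TransGen.single hx)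
      exact ⟨r, hr, Relation.ReflTransGen.head hx hd⟩

lemma Descendant.eq_of_root {f : Fin n → Option (Fin n)} {r v : Fin n} (hr : f r = none)
    (h : Descendant f v r) : v = r := by
  rcases Relation.ReflTransGen.cases_head h with h | ⟨c, hc, -⟩
  · exact h.symm
  · simp [hr] at hc

lemma root_unique {f : Fin n → Option (Fin n)} {r r' x : Fin n} (hr : f r = none)
    (hr' : f r' = none) (h : Descendant f r x) (h' : Descendant f r' x) : r = r' := by
  rcases Relation.ReflTransGen.total_of_right_unique
    (fun a b c (hb : f a = some b) (hc : f a = some c) => by simpa [hb] using hc) h h' with h | h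
  · exact (Descendant.eq_of_root hr h).symm
  · exact Descendant.eq_of_root hr' h

lemma glueForest_eq_some_iff {d : SplitData n (Fin n → Option (Fin n))}
    (hd : d ∈ forestSplits S m) (a b : Fin n) :
    glueForest d a = some b ↔
      (a ∈ d.block ∧ a ≠ d.root ∧ d.inner a = none ∧ b = d.root) ∨
        d.inner a = some b ∨ d.outer a = some b := by
  obtain ⟨-, -, -, h₁, h₂⟩ := hd
  have e₁ := fun b => h₁.2 a b
  have e₂ := fun b => h₂.2 a b
  unfold glueForest
  cases hi : d.inner a <;> cases ho : d.outer a <;> grind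

lemma glueForest_root {d : SplitData n (Fin n → Option (Fin n))}
    (hd : d ∈ forestSplits S m) : glueForest d d.root = none := by
  simp [glueForest, hd.2.2.1]

lemma glueForest_transGen {d : SplitData n (Fin n → Option (Fin n))}
    (hd : d ∈ forestSplits S m) {a b : Fin n}
    (h : Relation.TransGen (fun a b => glueForest d a = some b) a b) :
    (a ∈ d.block ∧ a ≠ d.root ∧ b = d.root) ∨
      (Relation.TransGen (fun a b => d.inner a = some b) a b ∧ a ∈ d.block ∧ b ∈ d.block ∧
        b ≠ d.root) ∨
      (Relation.TransGen (fun a b => d.outer a = some b) a b ∧ a ∉ d.block ∧ b ∉ d.block) := by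
  have h₁ := hd.2.2.2.1.2
  have h₂ := hd.2.2.2.2.2
  induction h with
  | single h =>
    rcases (glueForest_eq_some_iff hd _ _).1 h with h | h | h
    · grind
    · have := h₁ _ _ h
      exact Or.inr (Or.inl ⟨.single h, by grind⟩)
    · have := h₂ _ _ h
      exact Or.inr (Or.inr ⟨.single h, by grind⟩)
  | @tail b c hab h ih =>
    rcases (glueForest_eq_some_iff hd _ _).1 h with h | h | h
    · have : a ≠ d.root := by
        rintro rfl
        obtain ⟨y, hy, -⟩ := Relation.TransGen.head'_iff.1 hab
        simp [glueForest_root hd] at hy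
      grind
    · have := h₁ _ _ h
      rcases ih with ih | ih | ih
      · grind
      · exact Or.inr (Or.inl ⟨ih.1.tail h, by grind⟩)
      · grind
    · have := h₂ _ _ h
      rcases ih with ih | ih | ih
      · have := hd.2.2.1
        grind
      · grind
      · exact Or.inr (Or.inr ⟨ih.1.tail h, by grind⟩)

lemma glueForest_mem {d : SplitData n (Fin n → Option (Fin n))}
    (hd : d ∈ forestSplits S m) : glueForest d ∈ forestsOn S := by
  refine ⟨fun v hv => ?_, fun v w h => ?_⟩
  · rcases glueForest_transGen hd hv with h | h | h
    · exact h.2.1 h.2.2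
    · exact hd.2.2.2.1.1 v h.1
    · exact hd.2.2.2.2.1 v h.1
  · have h₀ := hd.1
    have h₁ := hd.2.2.2.1.2 v w
    have h₂ := hd.2.2.2.2.2 v w
    have h₃ := hd.2.2.1
    rcases (glueForest_eq_some_iff hd _ _).1 h with h | h | h <;> grind

lemma descendant_glueForest_root_iff {d : SplitData n (Fin n → Option (Fin n))}
    (hd : d ∈ forestSplits S m) (x : Fin n) :
    Descendant (glueForest d) d.root x ↔ x ∈ d.block := by
  constructor
  · intro h
    rcases Relation.reflTransGen_iff_eq_or_transGen.1 h with h | h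
    · exact h ▸ hd.2.2.1
    · have := hd.2.2.1
      have := glueForest_transGen hd h
      grind
  · intro hx
    obtain ⟨r, hr, h⟩ := exists_root (glueForest_mem hd).1 x
    have : r = d.root := by
      by_contra hne
      have hr' : r ∈ d.block := by
        rcases Relation.reflTransGen_iff_eq_or_transGen.1 h with h | h
        · exact h ▸ hx
        · have := glueForest_transGen hd h
          grind
      simp [glueForest, hr', hne] at hr
    exact this ▸ h

lemma descendant_glueForest_inner_iff {d : SplitData n (Fin n → Option (Fin n))}
    (hd : d ∈ forestSplits S m) {v : Fin n} (hv : v ∈ d.block.erase d.root) (x : Fin n) :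
    Descendant (glueForest d) v x ↔ Descendant d.inner v x := by
  constructor
  · intro h
    rcases Relation.reflTransGen_iff_eq_or_transGen.1 h with h | h
    · exact h ▸ .refl
    · rcases glueForest_transGen hd h with h | h | h
      · grind
      · exact h.1.to_reflTransGen
      · grind
  · exact Relation.ReflTransGen.mono
      (fun a b h => (glueForest_eq_some_iff hd a b).2 (Or.inr (Or.inl h))) x v

lemma descendant_glueForest_outer_iff {d : SplitData n (Fin n → Option (Fin n))}
    (hd : d ∈ forestSplits S m) {v : Fin n} (hv : v ∉ d.block) (x : Fin n) :
    Descendant (glueForest d) v x ↔ Descendant d.outer v x := by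
  constructor
  · intro h
    rcases Relation.reflTransGen_iff_eq_or_transGen.1 h with h | h
    · exact h ▸ .refl
    · have := hd.2.2.1
      rcases glueForest_transGen hd h with h | h | h
      · grind
      · grind
      · exact h.1.to_reflTransGen
  · exact Relation.ReflTransGen.mono
      (fun a b h => (glueForest_eq_some_iff hd a b).2 (Or.inr (Or.inr h))) x v

lemma map_val_split {α : Type*} {T : Finset (Fin n)} {r : Fin n} (hT : T ⊆ S) (hr : r ∈ T)
    (g : Fin n → α) :
    S.val.map g = g r ::ₘ ((T.erase r).val.map g + (S \ T).val.map g) := by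
  have h₁ : T.val + (S \ T).val = S.val := by
    rw [← Finset.disjUnion_val _ _ Finset.disjoint_sdiff, Finset.disjUnion_eq_union,
      Finset.union_sdiff_of_subset hT]
  have h₂ : r ::ₘ (T.erase r).val = T.val := by
    rw [Finset.erase_val]
    exact Multiset.cons_erase hr
  rw [← h₁, ← h₂]
  simp

lemma invMultiset_glueForest {d : SplitData n (Fin n → Option (Fin n))}
    (hd : d ∈ forestSplits S m) :
    invMultiset S (glueForest d) = rankIn d.block d.root ::ₘ
      (invMultiset (d.block.erase d.root) d.inner + invMultiset (S \ d.block) d.outer) := by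
  unfold invMultiset
  rw [map_val_split hd.1 hd.2.2.1]
  congr 1
  · unfold invAt rankIn
    rw [← Set.ncard_coe_finset]
    congr 1
    ext x
    simp [descendant_glueForest_root_iff hd, and_comm]
  · congr 1
    · refine Multiset.map_congr rfl fun v hv => ?_
      simp only [invAt, descendant_glueForest_inner_iff hd hv]
    · refine Multiset.map_congr rfl fun v hv => ?_
      simp only [invAt, descendant_glueForest_outer_iff hd
        (Finset.mem_sdiff.1 hv).2]

lemma forestSplits_inner_eq {d : SplitData n (Fin n → Option (Fin n))}
    (hd : d ∈ forestSplits S m) (v : Fin n) :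
    d.inner v = if v ∈ d.block ∧ glueForest d v ≠ some d.root then glueForest d v else none := by
  have h₁ := hd.2.2.2.1.2 v
  have h₃ := hd.2.2.1
  unfold glueForest
  cases hi : d.inner v <;> grind

lemma forestSplits_outer_eq {d : SplitData n (Fin n → Option (Fin n))}
    (hd : d ∈ forestSplits S m) (v : Fin n) :
    d.outer v = if v ∈ d.block then none else glueForest d v := by
  have h₁ := hd.2.2.2.2.2 v
  unfold glueForest
  cases hi : d.outer v <;> grind

lemma glueForest_injOn : Set.InjOn glueForest (forestSplits S m) := by
  intro d hd d' hd' h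
  have hroot : d.root = d'.root := by
    refine root_unique (glueForest_root hd) (h ▸ glueForest_root hd')
      ((descendant_glueForest_root_iff hd m).2 hd.2.1) ?_
    rw [h]
    exact (descendant_glueForest_root_iff hd' m).2 hd'.2.1
  have hblock : d.block = d'.block := by
    ext x
    rw [← descendant_glueForest_root_iff hd, ← descendant_glueForest_root_iff hd', h, hroot]
  have hinner : d.inner = d'.inner := by
    ext1 v
    rw [forestSplits_inner_eq hd, forestSplits_inner_eq hd', h, hroot, hblock]
  have houter : d.outer = d'.outer := by
    ext1 v
    rw [forestSplits_outer_eq hd, forestSplits_outer_eq hd', h, hblock]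
  cases d
  cases d'
  simp_all

lemma glueForest_surjOn (hm : m ∈ S) :
    Set.SurjOn glueForest (forestSplits S m) (forestsOn S) := by
  classical
  rintro f ⟨hf, hS⟩
  obtain ⟨r, hr, hrm⟩ := exists_root hf m
  have hmem {x : Fin n} (h : Descendant f r x) : x ≠ r → ∃ y, f x = some y ∧ Descendant f r y := by
    intro hne
    rcases Relation.ReflTransGen.cases_head h with h | ⟨c, hc, h⟩
    · exact absurd h hne
    · exact ⟨c, hc, h⟩
  have hrS : r ∈ S := by
    rcases Relation.ReflTransGen.cases_tail hrm with h | ⟨c, -, hc⟩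
    · exact h ▸ hm
    · exact (hS _ _ hc).2
  let T : Finset (Fin n) := Finset.univ.filter (Descendant f r)
  have hT (x : Fin n) : x ∈ T ↔ Descendant f r x := by simp [T]
  have hrT : r ∈ T := (hT r).2 .refl
  have hstep {x y : Fin n} (h : f x = some y) : x ∈ T ↔ y ∈ T := by
    rw [hT, hT]
    constructor
    · intro hx
      have : x ≠ r := by
        rintro rfl
        simp [hr] at h
      obtain ⟨z, hz, hz'⟩ := hmem hx this
      obtain rfl : y = z := by simpa [h] using hz
      exact hz'
    · exact Relation.ReflTransGen.head h
  let d : SplitData n (Fin n → Option (Fin n)) :=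
    ⟨T, r, fun v => if v ∈ T ∧ f v ≠ some r then f v else none,
      fun v => if v ∈ T then none else f v⟩
  refine ⟨d, ⟨fun x hx => ?_, (hT m).2 hrm, hrT, ⟨fun v hv => hf v ?_, fun v w h => ?_⟩,
    ⟨fun v hv => hf v ?_, fun v w h => ?_⟩⟩, ?_⟩
  · by_cases hxr : x = r
    · exact hxr ▸ hrS
    · obtain ⟨y, hy, -⟩ := hmem ((hT x).1 hx) hxr
      exact (hS _ _ hy).1
  · exact Relation.TransGen.mono (fun a b (h : d.inner a = some b) => by grind) v v hv
  · change (if v ∈ T ∧ f v ≠ some r then f v else none) = some w at h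
    change v ∈ T.erase r ∧ w ∈ T.erase r
    have := @hstep v w
    grind
  · exact Relation.TransGen.mono (fun a b (h : d.outer a = some b) => by grind) v v hv
  · change (if v ∈ T then none else f v) = some w at h
    change v ∈ S \ T ∧ w ∈ S \ T
    have := @hstep v w
    have := hS v w
    grind
  · ext1 v
    change (if v ∈ T then if v = r then none else
      some ((if v ∈ T ∧ f v ≠ some r then f v else none).getD r)
      else if v ∈ T then none else f v) = f v
    by_cases hv : v ∈ T
    · by_cases hvr : v = r
      · simp [hvr, hr]
      · obtain ⟨y, hy, -⟩ := hmem ((hT v).1 hv) hvr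
        by_cases hyr : y = r <;> simp [hv, hvr, hy, hyr]
    · simp [hv]

lemma glueForest_bijOn (hm : m ∈ S) :
    Set.BijOn glueForest (forestSplits S m) (forestsOn S) :=
  ⟨fun _ => glueForest_mem, glueForest_injOn, glueForest_surjOn hm⟩

end Forest

/-! ### Parking functions supported on a finite set of cars -/

/-- The space in which car `i` parks when only the cars in `S` take part. -/
noncomputable def parkOn {n : ℕ} (S : Finset (Fin n)) (p : Fin n → ℕ) (i : Fin n) : ℕ :=
  sInf {s : ℕ | p i ≤ s ∧ ∀ j : Fin n, j < i → j ∈ S → parkOn S p j ≠ s}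
termination_by i.val
decreasing_by exact ‹_ < _›

/-- `q` describes a run of the parking algorithm for the cars in `S` with preferences `p`. -/
def Parks {n : ℕ} (S : Finset (Fin n)) (p q : Fin n → ℕ) : Prop :=
  ∀ i ∈ S, p i ≤ q i ∧ (∀ j ∈ S, j < i → q j ≠ q i) ∧
    ∀ s, p i ≤ s → s < q i → ∃ j ∈ S, j < i ∧ q j = s

/-- Parking functions on the set `S` of cars, extended by zero. -/
def parkingOn {n : ℕ} (S : Finset (Fin n)) : Set (Fin n → ℕ) :=
  {p | (∀ v, v ∉ S → p v = 0) ∧ (∀ v ∈ S, 1 ≤ p v) ∧ ∀ v ∈ S, parkOn S p v ≤ S.card}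

/-- The multiset of the jumps of the cars in `S`. -/
noncomputable def jumpMultiset {n : ℕ} (S : Finset (Fin n)) (p : Fin n → ℕ) : Multiset ℕ :=
  S.val.map fun v => parkOn S p v - p v

/-- The splittings of parking functions on `S` with last car `m`; the permutation `σ` translates
the block into a set of cars. -/
def parkingSplits {n : ℕ} (σ : Equiv.Perm (Fin n)) (S : Finset (Fin n)) (m : Fin n) :
    Set (SplitData n (Fin n → ℕ)) :=
  {d | d.block.map σ.toEmbedding ⊆ S ∧ m ∈ d.block.map σ.toEmbedding ∧ d.root ∈ d.block ∧
    d.inner ∈ parkingOn ((d.block.map σ.toEmbedding).erase m) ∧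
    d.outer ∈ parkingOn (S \ d.block.map σ.toEmbedding)}

/-- Let the last car `m` join the two groups of cars. -/
def glueParking {n : ℕ} (σ : Equiv.Perm (Fin n)) (S : Finset (Fin n)) (m : Fin n)
    (d : SplitData n (Fin n → ℕ)) (v : Fin n) : ℕ :=
  if v = m then d.block.card - rankIn d.block d.root
  else if v ∈ d.block.map σ.toEmbedding then d.inner v
  else if v ∈ S then d.outer v + d.block.card else 0

section Parking

variable {n : ℕ} {σ : Equiv.Perm (Fin n)} {S : Finset (Fin n)} {m : Fin n}

lemma sInf_free_spec (T : Finset ℕ) (a : ℕ) :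
    let q := sInf {s : ℕ | a ≤ s ∧ s ∉ T}
    a ≤ q ∧ q ∉ T ∧ ∀ s, a ≤ s → s < q → s ∈ T := by
  have hne : {s : ℕ | a ≤ s ∧ s ∉ T}.Nonempty := by
    obtain ⟨x, hx, hx'⟩ := (Set.Ici_infinite a).exists_notMem_finset T
    exact ⟨x, hx, hx'⟩
  have hmem := Nat.sInf_mem hne
  refine ⟨hmem.1, hmem.2, fun s hs hlt => ?_⟩
  by_contra hT
  exact Nat.notMem_of_lt_sInf hlt ⟨hs, hT⟩

lemma parks_of_eq_sInf {p q : Fin n → ℕ}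
    (h : ∀ i, q i = sInf {s : ℕ | p i ≤ s ∧ ∀ j : Fin n, j < i → j ∈ S → q j ≠ s}) :
    Parks S p q := by
  intro i _
  have key := sInf_free_spec ((S.filter (· < i)).image q) (p i)
  have hset : {s : ℕ | p i ≤ s ∧ s ∉ (S.filter (· < i)).image q} =
      {s : ℕ | p i ≤ s ∧ ∀ j : Fin n, j < i → j ∈ S → q j ≠ s} := by
    ext s
    simp only [Set.mem_ofPred_eq, Finset.mem_image, Finset.mem_filter]
    grind
  rw [hset, ← h i] at key
  simp only [Finset.mem_image, Finset.mem_filter] at key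
  grind

lemma parks_parkOn (S : Finset (Fin n)) (p : Fin n → ℕ) : Parks S p (parkOn S p) :=
  parks_of_eq_sInf fun i => by rw [parkOn]

lemma parks_PA (p : Fin n → ℕ) : Parks Finset.univ p (PA p) :=
  parks_of_eq_sInf fun i => by
    rw [PA]
    simp

lemma Parks.eq {p q q' : Fin n → ℕ} (h : Parks S p q) (h' : Parks S p q') :
    ∀ i ∈ S, q i = q' i := by
  intro i
  induction i using WellFoundedLT.induction with
  | _ i ih =>
    intro hi
    obtain ⟨h₁, h₂, h₃⟩ := h i hi
    obtain ⟨h₁', h₂', h₃'⟩ := h' i hi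
    rcases lt_trichotomy (q i) (q' i) with hlt | heq | hlt
    · obtain ⟨j, hj, hji, hq⟩ := h₃' _ h₁ hlt
      exact absurd ((ih j hji hj).trans hq) (h₂ j hj hji)
    · exact heq
    · obtain ⟨j, hj, hji, hq⟩ := h₃ _ h₁' hlt
      exact absurd ((ih j hji hj).symm.trans hq) (h₂' j hj hji)

lemma Parks.injOn {p q : Fin n → ℕ} (h : Parks S p q) : Set.InjOn q S := by
  intro i hi j hj hij
  rcases lt_trichotomy i j with hlt | heq | hlt
  · exact absurd hij ((h j hj).2.1 i hi hlt)
  · exact heq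
  · exact absurd hij.symm ((h i hi).2.1 j hj hlt)

lemma Parks.image_eq {p q : Fin n → ℕ} (h : Parks S p q) (hp : ∀ v ∈ S, 1 ≤ p v)
    (hq : ∀ v ∈ S, q v ≤ S.card) : S.image q = Finset.Icc 1 S.card := by
  apply Finset.eq_of_subset_of_card_le
  · intro s hs
    obtain ⟨v, hv, rfl⟩ := Finset.mem_image.1 hs
    exact Finset.mem_Icc.2 ⟨(hp v hv).trans (h v hv).1, hq v hv⟩
  · rw [Finset.card_image_of_injOn h.injOn]
    simp

lemma Parks.card_filter_le {p q : Fin n → ℕ} (h : Parks S p q) (hp : ∀ v ∈ S, 1 ≤ p v)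
    (hq : ∀ v ∈ S, q v ≤ S.card) {k : ℕ} (hk : k ≤ S.card) :
    (S.filter (q · ≤ k)).card = k := by
  have himage : (S.filter (q · ≤ k)).image q = Finset.Icc 1 k := by
    rw [← Finset.filter_image (p := (· ≤ k)), h.image_eq hp hq]
    ext s
    simp only [Finset.mem_filter, Finset.mem_Icc]
    omega
  rw [← Finset.card_image_of_injOn (h.injOn.mono (Finset.coe_subset.2 (Finset.filter_subset _ _))),
    himage]
  simp

lemma rankIn_lt {T : Finset (Fin n)} {r : Fin n} (hr : r ∈ T) : rankIn T r < T.card :=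
  Finset.card_lt_card ⟨Finset.filter_subset _ _, fun h => by simpa using h hr⟩

lemma rankIn_injOn (T : Finset (Fin n)) : Set.InjOn (rankIn T) T := by
  have hlt {a b : Fin n} (ha : a ∈ T) (hab : a < b) : rankIn T a < rankIn T b := by
    refine Finset.card_lt_card ⟨fun x hx => ?_, fun h => ?_⟩
    · simp only [Finset.mem_filter] at hx ⊢
      exact ⟨hx.1, hx.2.trans hab⟩
    · simpa using h (Finset.mem_filter.2 ⟨ha, hab⟩)
  intro a ha b hb hab
  rcases lt_trichotomy a b with h | h | h
  · exact absurd hab (hlt ha h).ne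
  · exact h
  · exact absurd hab (hlt hb h).ne'

lemma exists_rankIn_eq {T : Finset (Fin n)} {k : ℕ} (hk : k < T.card) :
    ∃ r ∈ T, rankIn T r = k := by
  have : T.image (rankIn T) = Finset.range T.card := by
    apply Finset.eq_of_subset_of_card_le
    · intro s hs
      obtain ⟨v, hv, rfl⟩ := Finset.mem_image.1 hs
      exact Finset.mem_range.2 (rankIn_lt hv)
    · rw [Finset.card_image_of_injOn (rankIn_injOn T)]
      simp
  exact Finset.mem_image.1 (this ▸ Finset.mem_range.2 hk)

/-- The outcome of the parking algorithm for a glued parking function. -/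
noncomputable def gluePark {n : ℕ} (σ : Equiv.Perm (Fin n)) (S : Finset (Fin n)) (m : Fin n)
    (d : SplitData n (Fin n → ℕ)) (v : Fin n) : ℕ :=
  if v = m then d.block.card
  else if v ∈ d.block.map σ.toEmbedding then parkOn ((d.block.map σ.toEmbedding).erase m) d.inner v
  else parkOn (S \ d.block.map σ.toEmbedding) d.outer v + d.block.card

lemma parks_gluePark (hm : ∀ v ∈ S, v ≤ m) {d : SplitData n (Fin n → ℕ)}
    (hd : d ∈ parkingSplits σ S m) : Parks S (glueParking σ S m d) (gluePark σ S m d) := by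
  obtain ⟨hU, hmU, hr, ⟨-, hp₁, hq₁⟩, -, hp₂, hq₂⟩ := hd
  have hP₁ := parks_parkOn ((d.block.map σ.toEmbedding).erase m) d.inner
  have hP₂ := parks_parkOn (S \ d.block.map σ.toEmbedding) d.outer
  have himage := hP₁.image_eq hp₁ hq₁
  have hrank := rankIn_lt hr
  have hcard := Finset.card_map (s := d.block) σ.toEmbedding
  rw [Finset.card_erase_of_mem hmU] at hq₁ himage
  unfold glueParking gluePark
  generalize d.block.map σ.toEmbedding = U at *
  generalize parkOn (U.erase m) d.inner = q₁ at *
  generalize parkOn (S \ U) d.outer = q₂ at *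
  have hpos₂ (v) (hv : v ∈ S \ U) : 1 ≤ q₂ v := (hp₂ v hv).trans (hP₂ v hv).1
  intro i hi
  by_cases him : i = m
  · subst him
    refine ⟨by simp, fun j hj hji => ?_, fun s hs hsi => ?_⟩
    · have := hq₁ j
      have := hpos₂ j
      grind
    · simp only [if_true] at hs hsi
      have : s ∈ (U.erase i).image q₁ := by
        rw [himage, Finset.mem_Icc]
        omega
      obtain ⟨j, hj, hjs⟩ := Finset.mem_image.1 this
      have hj' := Finset.mem_erase.1 hj
      exact ⟨j, hU hj'.2, lt_of_le_of_ne (hm j (hU hj'.2)) hj'.1, by simp [hj'.1, hj'.2, hjs]⟩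
  · have hjm (j) (hji : j < i) : j ≠ m := (hji.trans_le (hm i hi)).ne
    by_cases hiU : i ∈ U
    · obtain ⟨h₁, h₂, h₃⟩ := hP₁ i (Finset.mem_erase.2 ⟨him, hiU⟩)
      have := hq₁ i (Finset.mem_erase.2 ⟨him, hiU⟩)
      simp only [him, hiU, if_true, if_false]
      refine ⟨h₁, fun j hj hji => ?_, fun s hs hsi => ?_⟩
      · have := hpos₂ j
        have := h₂ j
        have := hjm j hji
        grind
      · obtain ⟨j, hj, hji, hjs⟩ := h₃ s hs hsi
        exact ⟨j, by grind⟩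
    · obtain ⟨h₁, h₂, h₃⟩ := hP₂ i (Finset.mem_sdiff.2 ⟨hi, hiU⟩)
      have := hpos₂ i (Finset.mem_sdiff.2 ⟨hi, hiU⟩)
      simp only [him, hiU, hi, if_true, if_false]
      refine ⟨by omega, fun j hj hji => ?_, fun s hs hsi => ?_⟩
      · have := hq₁ j
        have := h₂ j
        have := hjm j hji
        grind
      · obtain ⟨j, hj, hji, hjs⟩ := h₃ (s - d.block.card) (by omega) (by omega)
        have := hjm j hji
        exact ⟨j, by grind⟩

lemma gluePark_le_iff {d : SplitData n (Fin n → ℕ)}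
    (hd : d ∈ parkingSplits σ S m) {v : Fin n} (hv : v ∈ S) :
    gluePark σ S m d v ≤ d.block.card ↔ v ∈ d.block.map σ.toEmbedding := by
  obtain ⟨hU, hmU, hr, ⟨-, hp₁, hq₁⟩, -, hp₂, hq₂⟩ := hd
  have hP₂ := parks_parkOn (S \ d.block.map σ.toEmbedding) d.outer v
  have hcard := Finset.card_map (s := d.block) σ.toEmbedding
  rw [Finset.card_erase_of_mem hmU] at hq₁
  have := hp₂ v
  have := hq₁ v
  unfold gluePark
  grind

lemma glueParking_mem (hm : ∀ v ∈ S, v ≤ m) {d : SplitData n (Fin n → ℕ)}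
    (hd : d ∈ parkingSplits σ S m) : glueParking σ S m d ∈ parkingOn S := by
  have heq := (parks_parkOn S _).eq (parks_gluePark hm hd)
  obtain ⟨hU, hmU, hr, ⟨-, hp₁, hq₁⟩, -, hp₂, hq₂⟩ := hd
  have hrank := rankIn_lt hr
  have hcard := Finset.card_map (s := d.block) σ.toEmbedding
  have hcard' := Finset.card_le_card hU
  rw [Finset.card_erase_of_mem hmU] at hq₁
  rw [Finset.card_sdiff_of_subset hU] at hq₂
  refine ⟨fun v hv => ?_, fun v hv => ?_, fun v hv => ?_⟩
  · have h₁ : v ≠ m := fun h => hv (hU (h ▸ hmU))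
    have h₂ : v ∉ d.block.map σ.toEmbedding := fun h => hv (hU h)
    simp only [glueParking, h₁, h₂, hv, if_false]
  · have := hp₁ v
    unfold glueParking
    grind
  · rw [heq v hv]
    have := hq₁ v
    have := hq₂ v
    unfold gluePark
    grind

lemma jumpMultiset_glueParking (hm : ∀ v ∈ S, v ≤ m) {d : SplitData n (Fin n → ℕ)}
    (hd : d ∈ parkingSplits σ S m) :
    jumpMultiset S (glueParking σ S m d) = rankIn d.block d.root ::ₘ
      (jumpMultiset ((d.block.map σ.toEmbedding).erase m) d.inner +
        jumpMultiset (S \ d.block.map σ.toEmbedding) d.outer) := by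
  have heq := (parks_parkOn S _).eq (parks_gluePark hm hd)
  have hrank := rankIn_lt hd.2.2.1
  unfold jumpMultiset
  rw [map_val_split hd.1 hd.2.1]
  congr 1
  · rw [heq m (hd.1 hd.2.1)]
    simp only [gluePark, glueParking, if_true]
    omega
  · congr 1
    · refine Multiset.map_congr rfl fun v hv => ?_
      have hv' := Finset.mem_erase.1 hv
      rw [heq v (hd.1 hv'.2)]
      simp only [gluePark, glueParking, hv'.1, hv'.2, if_true, if_false]
    · refine Multiset.map_congr rfl fun v hv => ?_
      have hv' := Finset.mem_sdiff.1 hv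
      have hvm : v ≠ m := fun h => hv'.2 (h ▸ hd.2.1)
      rw [heq v hv'.1]
      simp only [gluePark, glueParking, hvm, hv'.1, hv'.2, if_true, if_false]
      omega

lemma glueParking_injOn (hm : ∀ v ∈ S, v ≤ m) :
    Set.InjOn (glueParking σ S m) (parkingSplits σ S m) := by
  intro d hd d' hd' h
  have heq := (parks_gluePark hm hd).eq (h ▸ parks_gluePark hm hd')
  have hmS := hd.1 hd.2.1
  have hcard : d.block.card = d'.block.card := by simpa [gluePark] using heq m hmS
  have hU : d.block.map σ.toEmbedding = d'.block.map σ.toEmbedding := by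
    ext v
    by_cases hv : v ∈ S
    · rw [← gluePark_le_iff hd hv, ← gluePark_le_iff hd' hv, heq v hv, hcard]
    · exact iff_of_false (fun h => hv (hd.1 h)) (fun h => hv (hd'.1 h))
  have hblock : d.block = d'.block := Finset.map_injective _ hU
  have hroot : d.root = d'.root := by
    refine rankIn_injOn d.block hd.2.2.1 (hblock ▸ hd'.2.2.1) ?_
    have h₁ := rankIn_lt hd.2.2.1
    have h₂ := rankIn_lt hd'.2.2.1
    have h₃ := congrFun h m
    simp only [glueParking, if_true] at h₃
    rw [← hblock] at h₂ h₃
    omega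
  have hinner : d.inner = d'.inner := by
    ext1 v
    have h₁ := hd.2.2.2.1.1 v
    have h₂ := hd'.2.2.2.1.1 v
    have h₃ := congrFun h v
    simp only [glueParking, ← hblock] at h₁ h₂ h₃
    grind
  have houter : d.outer = d'.outer := by
    ext1 v
    have h₀ := hd.2.1
    have h₁ := hd.2.2.2.2.1 v
    have h₂ := hd'.2.2.2.2.1 v
    have h₃ := congrFun h v
    simp only [glueParking, ← hblock] at h₁ h₂ h₃
    grind
  cases d
  cases d'
  simp_all

lemma glueParking_surjOn (hmS : m ∈ S) (hm : ∀ v ∈ S, v ≤ m) :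
    Set.SurjOn (glueParking σ S m) (parkingSplits σ S m) (parkingOn S) := by
  rintro p ⟨hp₀, hp₁, hq⟩
  have hP := parks_parkOn S p
  generalize parkOn S p = q at *
  obtain ⟨k, hk⟩ : ∃ k, k = q m := ⟨_, rfl⟩
  obtain ⟨U, hU⟩ : ∃ U, U = S.filter (q · ≤ k) := ⟨_, rfl⟩
  have hmemU (v) : v ∈ U ↔ v ∈ S ∧ q v ≤ k := by simp [hU]
  have hUcard : U.card = k := by rw [hU, hP.card_filter_le hp₁ hq (hk ▸ hq m hmS)]
  have hmU : m ∈ U := by simp [hmemU, hmS, hk]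
  have hUS : U ⊆ S := fun v hv => ((hmemU v).1 hv).1
  have hbm : (U.map σ.symm.toEmbedding).map σ.toEmbedding = U := by
    ext x
    simp
  have hbcard : (U.map σ.symm.toEmbedding).card = k := by rw [Finset.card_map, hUcard]
  have hpm := hp₁ m hmS
  have hpqm := (hP m hmS).1
  obtain ⟨r, hr, hrank⟩ := exists_rankIn_eq (T := U.map σ.symm.toEmbedding) (k := k - p m)
    (by omega)
  have hinj := hP.injOn
  have hltm {v : Fin n} (hv : v ∈ S) (hvm : v ≠ m) : q v ≠ k := fun h =>
    hvm (hinj hv hmS (h.trans hk))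
  have hbig {v : Fin n} (hv : v ∈ S \ U) : k < p v := by
    by_contra! hle
    have hv' := Finset.mem_sdiff.1 hv
    have : k < q v := by
      by_contra! h
      exact hv'.2 ((hmemU v).2 ⟨hv'.1, h⟩)
    obtain ⟨j, hj, hjv, hjk⟩ := (hP v hv'.1).2.2 k hle this
    exact hltm hj (hjv.trans_le (hm v hv'.1)).ne hjk
  have hP₁ : Parks (U.erase m) (fun v => if v ∈ U.erase m then p v else 0) q := by
    intro v hv
    have hv' := Finset.mem_erase.1 hv
    have hvU := (hmemU v).1 hv'.2
    obtain ⟨h₁, h₂, h₃⟩ := hP v hvU.1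
    simp only [hv, if_true]
    refine ⟨h₁, fun j hj => h₂ j (hUS (Finset.mem_of_mem_erase hj)), fun s hs hsv => ?_⟩
    obtain ⟨j, hj, hjv, hjs⟩ := h₃ s hs hsv
    refine ⟨j, Finset.mem_erase.2 ⟨(hjv.trans_le (hm v hvU.1)).ne, (hmemU j).2 ⟨hj, ?_⟩⟩, hjv, hjs⟩
    omega
  have hP₂ : Parks (S \ U) (fun v => if v ∈ S \ U then p v - k else 0) (fun v => q v - k) := by
    intro v hv
    have hv' := Finset.mem_sdiff.1 hv
    obtain ⟨h₁, h₂, h₃⟩ := hP v hv'.1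
    have hkv := hbig hv
    simp only [hv, if_true]
    refine ⟨by omega, fun j hj hjv => ?_, fun s hs hsv => ?_⟩
    · have := h₂ j (Finset.mem_sdiff.1 hj).1 hjv
      have := hbig hj
      have := (hP j (Finset.mem_sdiff.1 hj).1).1
      omega
    · obtain ⟨j, hj, hjv, hjs⟩ := h₃ (s + k) (by omega) (by omega)
      refine ⟨j, Finset.mem_sdiff.2 ⟨hj, fun hjU => ?_⟩, hjv, by omega⟩
      have := ((hmemU j).1 hjU).2
      omega
  refine ⟨⟨U.map σ.symm.toEmbedding, r, fun v => if v ∈ U.erase m then p v else 0,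
    fun v => if v ∈ S \ U then p v - k else 0⟩, ?_, ?_⟩
  · simp only [parkingSplits, Set.mem_ofPred_eq, hbm]
    refine ⟨hUS, hmU, hr, ⟨fun v hv => by simp only [hv, if_false], fun v hv => ?_, fun v hv => ?_⟩,
      fun v hv => by simp only [hv, if_false], fun v hv => ?_, fun v hv => ?_⟩
    · simp only [hv, if_true]
      exact hp₁ v (hUS (Finset.mem_of_mem_erase hv))
    · rw [(parks_parkOn _ _).eq hP₁ v hv, Finset.card_erase_of_mem hmU, hUcard]
      have hv' := Finset.mem_erase.1 hv
      have := (hmemU v).1 hv'.2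
      have := hltm this.1 hv'.1
      omega
    · simp only [hv, if_true]
      have := hbig hv
      omega
    · rw [(parks_parkOn _ _).eq hP₂ v hv, Finset.card_sdiff_of_subset hUS, hUcard]
      have := hq v (Finset.mem_sdiff.1 hv).1
      omega
  · ext1 v
    simp only [glueParking, hbm, hbcard, hrank]
    have := @hbig v
    have := hp₀ v
    grind

lemma glueParking_bijOn (hmS : m ∈ S) (hm : ∀ v ∈ S, v ≤ m) :
    Set.BijOn (glueParking σ S m) (parkingSplits σ S m) (parkingOn S) :=
  ⟨fun _ => glueParking_mem hm, glueParking_injOn hm, glueParking_surjOn hmS hm⟩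

end Parking

/-! ### The bijection -/

lemma exists_perm_map_eq {n : ℕ} {S S' : Finset (Fin n)} (h : S.card = S'.card) :
    ∃ σ : Equiv.Perm (Fin n), S.map σ.toEmbedding = S' := by
  let e : {x // x ∈ S} ≃ {x // x ∈ S'} := Finset.equivOfCardEq h
  refine ⟨e.extendSubtype, Finset.eq_of_subset_of_card_le (fun x hx => ?_) ?_⟩
  · obtain ⟨y, hy, rfl⟩ := Finset.mem_map.1 hx
    exact e.extendSubtype_mem y hy
  · rw [Finset.card_map, h]

/-- A statistic-preserving bijection between forests on `S` and parking functions on `S'`. -/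
def IsForestParkingBij {n : ℕ} (S S' : Finset (Fin n))
    (φ : (Fin n → Option (Fin n)) → Fin n → ℕ) : Prop :=
  Set.BijOn φ (forestsOn S) (parkingOn S') ∧
    ∀ f ∈ forestsOn S, jumpMultiset S' (φ f) = invMultiset S f

lemma isForestParkingBij_empty {n : ℕ} :
    IsForestParkingBij (∅ : Finset (Fin n)) ∅ fun _ _ => 0 := by
  refine ⟨⟨fun f _ => ?_, fun f hf g hg _ => ?_, fun p hp => ?_⟩, fun f _ => rfl⟩
  · simp [parkingOn]
  · have hnone {f : Fin n → Option (Fin n)} (hf : f ∈ forestsOn ∅) (v : Fin n) : f v = none :=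
      Option.eq_none_iff_forall_ne_some.2 fun w hw => by simpa using hf.2 v w hw
    ext1 v
    rw [hnone hf, hnone hg]
  · refine ⟨fun _ => none, ⟨fun v hv => ?_, by simp⟩, ?_⟩
    · obtain ⟨y, hy, -⟩ := Relation.TransGen.head'_iff.1 hv
      simp at hy
    · ext1 v
      exact (hp.1 v (by simp)).symm

lemma exists_isForestParkingBij {n : ℕ} (S S' : Finset (Fin n)) (h : S.card = S'.card) :
    ∃ φ, IsForestParkingBij S S' φ := by
  induction hk : S.card using Nat.strong_induction_on generalizing S S' with
  | _ k ih =>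
  subst hk
  rcases S'.eq_empty_or_nonempty with rfl | hne
  · obtain rfl : S = ∅ := by simpa using h
    exact ⟨_, isForestParkingBij_empty⟩
  obtain ⟨σ, hσ⟩ := exists_perm_map_eq h
  let m' := S'.max' hne
  have hm' : m' ∈ S' := S'.max'_mem hne
  obtain ⟨m, hm, hmm⟩ : ∃ m ∈ S, σ m = m' := Finset.mem_map.1 (hσ ▸ hm')
  have ih' (A A' : Finset (Fin n)) :
      ∃ φ, A.card < S.card → A.card = A'.card → IsForestParkingBij A A' φ := by
    by_cases hA : A.card < S.card ∧ A.card = A'.card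
    · obtain ⟨φ, hφ⟩ := ih A.card hA.1 A A' hA.2 rfl
      exact ⟨φ, fun _ _ => hφ⟩
    · exact ⟨fun _ _ => 0, fun h₁ h₂ => absurd ⟨h₁, h₂⟩ hA⟩
  choose φ hφ using ih'
  have hmem (T : Finset (Fin n)) : m' ∈ T.map σ.toEmbedding ↔ m ∈ T := by
    rw [← hmm]
    exact Finset.mem_map' σ.toEmbedding
  have hsub (T : Finset (Fin n)) : T.map σ.toEmbedding ⊆ S' ↔ T ⊆ S := by
    rw [← hσ, Finset.map_subset_map]
  have hinner {T : Finset (Fin n)} {r : Fin n} (hT : T ⊆ S) (hmT : m ∈ T) (hr : r ∈ T) :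
      IsForestParkingBij (T.erase r) ((T.map σ.toEmbedding).erase m')
        (φ (T.erase r) ((T.map σ.toEmbedding).erase m')) := by
    have := Finset.card_le_card hT
    have := Finset.card_pos.2 ⟨m, hmT⟩
    apply hφ
    · rw [Finset.card_erase_of_mem hr]
      omega
    · rw [Finset.card_erase_of_mem hr, Finset.card_erase_of_mem ((hmem T).2 hmT), Finset.card_map]
  have houter {T : Finset (Fin n)} (hT : T ⊆ S) (hmT : m ∈ T) :
      IsForestParkingBij (S \ T) (S' \ T.map σ.toEmbedding)
        (φ (S \ T) (S' \ T.map σ.toEmbedding)) := by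
    have := Finset.card_le_card hT
    have := Finset.card_pos.2 ⟨m, hmT⟩
    apply hφ
    · rw [Finset.card_sdiff_of_subset hT]
      omega
    · rw [Finset.card_sdiff_of_subset hT, Finset.card_sdiff_of_subset ((hsub T).2 hT),
        Finset.card_map, h]
  let ψ : SplitData n (Fin n → Option (Fin n)) → SplitData n (Fin n → ℕ) := fun d =>
    ⟨d.block, d.root, φ (d.block.erase d.root) ((d.block.map σ.toEmbedding).erase m') d.inner,
      φ (S \ d.block) (S' \ d.block.map σ.toEmbedding) d.outer⟩
  have hψ : Set.BijOn ψ (forestSplits S m) (parkingSplits σ S' m') := by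
    refine ⟨?_, ?_, ?_⟩
    · rintro ⟨T, r, f, g⟩ ⟨hT, hmT, hr, hf, hg⟩
      exact ⟨(hsub T).2 hT, (hmem T).2 hmT, hr, (hinner hT hmT hr).1.mapsTo hf,
        (houter hT hmT).1.mapsTo hg⟩
    · rintro ⟨T, r, f, g⟩ ⟨hT, hmT, hr, hf, hg⟩ ⟨T', r', f', g'⟩ ⟨_, _, _, hf', hg'⟩ heq
      simp only [ψ, SplitData.mk.injEq] at heq
      obtain ⟨rfl, rfl, h₁, h₂⟩ := heq
      obtain rfl := (hinner hT hmT hr).1.injOn hf hf' h₁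
      obtain rfl := (houter hT hmT).1.injOn hg hg' h₂
      rfl
    · rintro ⟨T, r, p, q⟩ ⟨hT, hmT, hr, hp, hq⟩
      have hT' := (hsub T).1 hT
      have hmT' := (hmem T).1 hmT
      obtain ⟨f, hf, hfp⟩ := (hinner hT' hmT' hr).1.surjOn hp
      obtain ⟨g, hg, hgq⟩ := (houter hT' hmT').1.surjOn hq
      exact ⟨⟨T, r, f, g⟩, ⟨hT', hmT', hr, hf, hg⟩, congrArg₂ (SplitData.mk T r) hfp hgq⟩
  have hmax (v) (hv : v ∈ S') : v ≤ m' := S'.le_max' v hv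
  have hF := glueForest_bijOn hm
  have : Nonempty (SplitData n (Fin n → Option (Fin n))) := ⟨⟨∅, m, fun _ => none, fun _ => none⟩⟩
  have hinv := hF.invOn_invFunOn
  have hFinv := hF.symm hinv.symm
  refine ⟨glueParking σ S' m' ∘ ψ ∘ Function.invFunOn glueForest (forestSplits S m),
    (glueParking_bijOn hm' hmax).comp (hψ.comp hFinv), fun f hf => ?_⟩
  obtain ⟨d, hd, rfl⟩ := hF.surjOn hf
  simp only [Function.comp_apply, hinv.1 hd]
  rw [jumpMultiset_glueParking hmax (hψ.mapsTo hd), invMultiset_glueForest hd]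
  simp only [ψ]
  rw [(hinner hd.1 hd.2.1 hd.2.2.1).2 _ hd.2.2.2.1, (houter hd.1 hd.2.1).2 _ hd.2.2.2.2]

lemma mem_parkingOn_univ_iff {n : ℕ} (p : Fin n → ℕ) :
    p ∈ parkingOn Finset.univ ↔ IsParkingFunction p := by
  have hP := parks_PA p
  have heq := (parks_parkOn _ _).eq hP
  constructor
  · rintro ⟨-, h₁, h₂⟩
    have h₃ (i : Fin n) : PA p i ≤ n := by
      simpa [heq i (Finset.mem_univ i)] using h₂ i (Finset.mem_univ i)
    exact ⟨fun i => ⟨h₁ i (Finset.mem_univ i), (hP i (Finset.mem_univ i)).1.trans (h₃ i)⟩, h₃⟩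
  · rintro ⟨h₁, h₂⟩
    refine ⟨by simp, fun v _ => (h₁ v).1, fun v hv => ?_⟩
    simpa [heq v hv] using h₂ v

lemma jumpMultiset_univ {n : ℕ} (p : Fin n → ℕ) :
    jumpMultiset Finset.univ p = Finset.univ.val.map (jumpAt p) :=
  Multiset.map_congr rfl fun v hv => by
    rw [(parks_parkOn _ _).eq (parks_PA p) v hv, jumpAt]

lemma IsParkingFunction.sum_PA {n : ℕ} {p : Fin n → ℕ} (hp : IsParkingFunction p) :
    ∑ i, PA p i = (n + 1).choose 2 := by
  have himage := (parks_PA p).image_eq (fun v _ => (hp.1 v).1) (by simpa using hp.2)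
  have hsum := Finset.sum_image (f := id) (parks_PA p).injOn
  rw [himage, Finset.card_univ, Fintype.card_fin] at hsum
  simp only [id] at hsum
  rw [← hsum, Nat.choose_two_right, ← Finset.sum_range_id, Finset.range_eq_Ico,
    Finset.sum_eq_sum_Ico_succ_bot (Nat.succ_pos n)]
  simp only [Nat.zero_add]
  rfl

lemma IsParkingFunction.jump_add_sum {n : ℕ} {p : Fin n → ℕ} (hp : IsParkingFunction p) :
    jump p + ∑ i, p i = (n + 1).choose 2 := by
  rw [← hp.sum_PA, jump, ← Finset.sum_add_distrib]
  exact Finset.sum_congr rfl fun i hi => Nat.sub_add_cancel (parks_PA p i hi).1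

lemma count_map_univ {n : ℕ} (g : Fin n → ℕ) (k : ℕ) :
    (Finset.univ.val.map g).count k = Set.ncard {v | g v = k} := by
  rw [Multiset.count_map, ← Finset.filter_val, Finset.card_val, ← Set.ncard_coe_finset]
  congr 1
  ext v
  simp [eq_comm]

/-- For every `n ≥ 1` there is a bijection `φ : F_n → PF_n` such that,
writing `φ F = (a_1, ..., a_n)`, one has `inv F = C(n+1,2) - (a_1 + ⋯ + a_n)` and
`lead F = lucky (φ F)`. -/
theorem exists_bijection_inv_lead (n : ℕ) (hn : 1 ≤ n) :
    ∃ φ : Forest n ≃ ParkingFunction n,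
      ∀ F : Forest n,
        (forestInv F : ℤ) = ((n + 1).choose 2 : ℤ) - ∑ i : Fin n, ((φ F).1 i : ℤ) ∧
        forestLead F = lucky (φ F).1 := by
  obtain ⟨φ, hφ, hstat⟩ := exists_isForestParkingBij (n := n) Finset.univ Finset.univ rfl
  have hmem (F : Forest n) : F.1 ∈ forestsOn Finset.univ := ⟨F.2, by simp⟩
  let Φ (F : Forest n) : ParkingFunction n :=
    ⟨φ F.1, (mem_parkingOn_univ_iff _).1 (hφ.mapsTo (hmem F))⟩
  have hΦ : Function.Bijective Φ := by
    constructor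
    · intro F G h
      exact Subtype.ext (hφ.injOn (hmem F) (hmem G) (congrArg Subtype.val h))
    · intro P
      obtain ⟨f, hf, h⟩ := hφ.surjOn ((mem_parkingOn_univ_iff _).2 P.2)
      exact ⟨⟨f, hf.1⟩, Subtype.ext h⟩
  refine ⟨Equiv.ofBijective Φ hΦ, fun F => ?_⟩
  have hF : Finset.univ.val.map (jumpAt (Φ F).1) = Finset.univ.val.map (forestInvAt F) := by
    rw [← jumpMultiset_univ]
    exact hstat F.1 (hmem F)
  constructor
  · have hinv : forestInv F = jump (Φ F).1 := congrArg Multiset.sum hF.symm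
    rw [Equiv.ofBijective_apply, hinv, ← (Φ F).2.jump_add_sum]
    push_cast
    ring
  · rw [Equiv.ofBijective_apply, forestLead, lucky, ← count_map_univ, ← count_map_univ, hF]
end
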